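/- arXiv:2502.04545 — 7 statements merged into one kernel-verified Lean document; each statement's English description precedes it below -/
import Mathlib

section
/- Let n ∈ {17, 19}. There exists a 5-dimensional F_2-subspace E of F_{2^n} that is a zero-sum subspace, i.e., ∑_{u∈E, u≠0} u^{-1} = 0. Consequently, f_inv is not 5th order sum-free on F_{2^17} and on F_{2^19}. -/
/-- The sum of the `b i` over the binary digits `i < k` of `m` that are equal to `1`. -/
def bitSum {R : Type*} [AddCommMonoid R] (b : ℕ → R) (k m : ℕ) : R :=
  ∑ i ∈ Finset.range k, if m.testBit i then b i else 0

/-- The bitwise exclusive or of `t 0, …, t (k - 1)`. -/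
def xorSum (t : ℕ → ℕ) : ℕ → ℕ
  | 0 => 0
  | k + 1 => xorSum t k ^^^ t k

/-- Reduction of a polynomial of degree at most `n` over `𝔽₂` modulo the polynomial `p` of
degree `n`, polynomials being encoded by the binary digits of natural numbers. -/
def reduceStep (n p y : ℕ) : ℕ := if y.testBit n then y ^^^ p else y

/-- The product of `a` and the `k` lowest binary digits of `b`, as polynomials over `𝔽₂`,
modulo the polynomial `p` of degree `n`. -/
def mulMod (n p a : ℕ) : ℕ → ℕ → ℕ
  | 0, _ => 0
  | k + 1, b => (if b.testBit 0 then a else 0) ^^^ reduceStep n p (2 * mulMod n p a k (b / 2))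

theorem bitSum_zero_right {R : Type*} [AddCommMonoid R] (b : ℕ → R) (k : ℕ) : bitSum b k 0 = 0 := by
  simp [bitSum]

theorem bitSum_one {R : Type*} [AddCommMonoid R] (b : ℕ → R) {k : ℕ} (hk : 0 < k) :
    bitSum b k 1 = b 0 := by
  rw [bitSum, Finset.sum_eq_single 0] <;>
    simp +contextual [Nat.testBit_one_eq_true_iff_self_eq_zero, hk.ne']

theorem bitSum_two {R : Type*} [AddCommMonoid R] (b : ℕ → R) {k : ℕ} (hk : 1 < k) :
    bitSum b k 2 = b 1 := by
  rw [bitSum, Finset.sum_eq_single 1]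
  · rw [if_pos (by decide)]
  · intro i _ hi
    rw [show 2 = 2 ^ 1 from rfl, Nat.testBit_two_pow_of_ne hi.symm]
    simp
  · simp [hk]

theorem bitSum_pow_succ {R : Type*} [CommRing R] (α : R) (k m : ℕ) :
    bitSum (α ^ ·) (k + 1) m =
      (if m.testBit 0 then 1 else 0) + α * bitSum (α ^ ·) k (m / 2) := by
  simp only [bitSum, Finset.sum_range_succ', Finset.mul_sum, Nat.testBit_succ, pow_zero]
  rw [add_comm]
  refine congrArg _ (Finset.sum_congr rfl fun i _ ↦ ?_)
  split_ifs <;> ring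

section BitSum

variable {R : Type*} [CommRing R] [Algebra (ZMod 2) R]

theorem bitSum_xor (b : ℕ → R) (k m m' : ℕ) :
    bitSum b k (m ^^^ m') = bitSum b k m + bitSum b k m' := by
  simp only [bitSum, ← Finset.sum_add_distrib, Nat.testBit_xor]
  refine Finset.sum_congr rfl fun i _ ↦ ?_
  cases m.testBit i <;> cases m'.testBit i <;> simp [ZModModule.add_self]

theorem bitSum_xorSum (b : ℕ → R) (k : ℕ) (t : ℕ → ℕ) (l : ℕ) :
    bitSum b k (xorSum t l) = ∑ i ∈ Finset.range l, bitSum b k (t i) := by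
  induction l with
  | zero => simp [xorSum, bitSum_zero_right]
  | succ l ih => rw [xorSum, bitSum_xor, ih, Finset.sum_range_succ]

theorem bitSum_bitSum (b : ℕ → R) (k : ℕ) (e : ℕ → ℕ) (l m : ℕ) :
    bitSum b k (xorSum (fun i ↦ if m.testBit i then e i else 0) l) =
      bitSum (fun i ↦ bitSum b k (e i)) l m := by
  rw [bitSum_xorSum, bitSum]
  refine Finset.sum_congr rfl fun i _ ↦ ?_
  split_ifs <;> simp [bitSum_zero_right]

theorem bitSum_reduceStep {α : R} {n p : ℕ} (hn : p.testBit n)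
    (hp : bitSum (α ^ ·) (n + 1) p = 0) (y : ℕ) :
    bitSum (α ^ ·) n (reduceStep n p y) = bitSum (α ^ ·) (n + 1) y := by
  have top (z : ℕ) (hz : z.testBit n = false) :
      bitSum (α ^ ·) n z = bitSum (α ^ ·) (n + 1) z := by
    simp [bitSum, Finset.sum_range_succ, hz]
  unfold reduceStep
  split_ifs with h
  · rw [top _ (by simp [h, hn]), bitSum_xor, hp, add_zero]
  · exact top _ (by simpa using h)

theorem bitSum_mulMod {α : R} {n p : ℕ} (hn : p.testBit n)
    (hp : bitSum (α ^ ·) (n + 1) p = 0) (a k b : ℕ) :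
    bitSum (α ^ ·) n (mulMod n p a k b) = bitSum (α ^ ·) n a * bitSum (α ^ ·) k b := by
  induction k generalizing b with
  | zero => simp [mulMod, bitSum]
  | succ k ih =>
    rw [mulMod, bitSum_xor, bitSum_reduceStep hn hp, bitSum_pow_succ α n (2 * _),
      bitSum_pow_succ α k b, Nat.mul_div_cancel_left _ two_pos, ih]
    split_ifs <;> simp_all [bitSum_zero_right] <;> ring

theorem bitSum_iterate_mulMod_self {α : R} {n p : ℕ} (hn : p.testBit n)
    (hp : bitSum (α ^ ·) (n + 1) p = 0) (a j : ℕ) :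
    bitSum (α ^ ·) n ((fun x ↦ mulMod n p x n x)^[j] a) = bitSum (α ^ ·) n a ^ 2 ^ j := by
  induction j with
  | zero => simp
  | succ j ih =>
    rw [Function.iterate_succ_apply', bitSum_mulMod hn hp, ih, ← pow_add, pow_succ, mul_two]

end BitSum

open Polynomial in
theorem GaloisField.exists_bitSum_pow_eq_zero {n p : ℕ} (hn : 1 < n) (hp : p.testBit n)
    (h : (fun x ↦ mulMod n p x n x)^[n] 2 = 2) :
    ∃ α : GaloisField 2 n, bitSum (α ^ ·) (n + 1) p = 0 := by
  set P : (ZMod 2)[X] := bitSum (X ^ ·) (n + 1) p with hP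
  have aeval_P {A : Type} [CommRing A] [Algebra (ZMod 2) A] (x : A) :
      aeval x P = bitSum (x ^ ·) (n + 1) p := by
    simp only [hP, bitSum, map_sum]
    exact Finset.sum_congr rfl fun i _ ↦ by split_ifs <;> simp
  have hdvd : P ∣ X ^ 2 ^ n - X := by
    rw [← AdjoinRoot.mk_eq_zero]
    have hroot : bitSum (AdjoinRoot.root P ^ ·) (n + 1) p = 0 := by
      rw [← aeval_P, AdjoinRoot.aeval_eq, AdjoinRoot.mk_self]
    have key := bitSum_iterate_mulMod_self hp hroot 2 n
    rw [h, bitSum_two _ hn, pow_one] at key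
    simp [← key]
  have hcoeff : P.coeff n = 1 := by
    simp only [hP, bitSum, Finset.sum_range_succ, hp, if_true, coeff_add, finsetSum_coeff,
      coeff_X_pow_self, add_eq_right]
    refine Finset.sum_eq_zero fun i hi ↦ ?_
    rw [Finset.mem_range] at hi
    split_ifs <;> simp [coeff_X_pow, hi.ne']
  have hne : (X ^ 2 ^ n - X : (ZMod 2)[X]) ≠ 0 :=
    FiniteField.X_pow_card_pow_sub_X_ne_zero _ (by lia) one_lt_two
  have hsplitting : IsSplittingField (ZMod 2) (GaloisField 2 n) (X ^ 2 ^ n - X) :=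
    inferInstanceAs (IsSplittingField (ZMod 2) (SplittingField (X ^ 2 ^ n - X)) _)
  have hsplits := (IsSplittingField.splits (GaloisField 2 n) (X ^ 2 ^ n - X : (ZMod 2)[X])).of_dvd
    (map_ne_zero hne) (map_dvd (mapRingHom (algebraMap (ZMod 2) (GaloisField 2 n))) hdvd)
  have hdeg : (P.map (algebraMap (ZMod 2) (GaloisField 2 n))).degree ≠ 0 := by
    rw [degree_map]
    have := le_degree_of_ne_zero (hcoeff ▸ one_ne_zero : P.coeff n ≠ 0)
    intro h0
    rw [h0] at this
    norm_cast at this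
    lia
  obtain ⟨α, hα⟩ := hsplits.exists_eval_eq_zero hdeg
  exact ⟨α, by rwa [← aeval_P, aeval_def, ← eval_map]⟩

/-- The additive subgroup generated by `b 0, …, b (k - 1)` in an `𝔽₂`-algebra, as a subspace. -/
def bitSpan {R : Type*} [CommRing R] [Algebra (ZMod 2) R] (b : ℕ → R) (k : ℕ) :
    Submodule (ZMod 2) R :=
  AddSubgroup.toZModSubmodule 2
    { carrier := Set.range (bitSum b k)
      zero_mem' := ⟨0, bitSum_zero_right b k⟩
      add_mem' := by
        rintro _ _ ⟨m, rfl⟩ ⟨m', rfl⟩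
        exact ⟨m ^^^ m', bitSum_xor b k m m'⟩
      neg_mem' := by
        rintro _ ⟨m, rfl⟩
        exact ⟨m, (ZModModule.neg_eq_self _).symm⟩ }

theorem mem_bitSpan {R : Type*} [CommRing R] [Algebra (ZMod 2) R] {b : ℕ → R} {k : ℕ} {x : R} :
    x ∈ bitSpan b k ↔ ∃ m < 2 ^ k, bitSum b k m = x := by
  refine ⟨?_, fun ⟨m, _, h⟩ ↦ ⟨m, h⟩⟩
  rintro ⟨m, rfl⟩
  refine ⟨m % 2 ^ k, Nat.mod_lt _ (by positivity), Finset.sum_congr rfl fun i hi ↦ ?_⟩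
  simp [Nat.testBit_mod_two_pow, Finset.mem_range.mp hi]

/-- If the nonzero combinations of `b 0, …, b (k - 1)` over `𝔽₂` have inverses `w m` with zero sum,
then these elements span a zero-sum subspace of dimension `k`. -/
theorem finrank_bitSpan_and_finsum_inv_eq_zero {K : Type*} [Field K] [Algebra (ZMod 2) K]
    {b w : ℕ → K} {k : ℕ}
    (hw : ∀ m < 2 ^ k, m ≠ 0 → bitSum b k m * w m = 1) (hw₀ : w 0 = 0)
    (hsum : ∑ m ∈ Finset.range (2 ^ k), w m = 0) :
    Module.finrank (ZMod 2) (bitSpan b k) = k ∧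
      ∑ᶠ u ∈ (bitSpan b k : Set K), u⁻¹ = 0 := by
  classical
  have hinj : Set.InjOn (bitSum b k) (Finset.range (2 ^ k)) := by
    intro m hm m' hm' h
    by_contra hne
    have := hw (m ^^^ m') (Nat.xor_lt_two_pow (by simpa using hm) (by simpa using hm'))
      (by simpa [Nat.xor_eq_zero_iff] using hne)
    rw [bitSum_xor, h, ZModModule.add_self, zero_mul] at this
    exact zero_ne_one this
  have hcoe : (bitSpan b k : Set K) = ((Finset.range (2 ^ k)).image (bitSum b k) : Finset K) := by
    ext x
    simp [mem_bitSpan]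
  constructor
  · have hcard : Nat.card (bitSpan b k) = 2 ^ k := by
      rw [← SetLike.coe_sort_coe, hcoe, Nat.card_coe_set_eq, Set.ncard_coe_finset,
        Finset.card_image_of_injOn hinj, Finset.card_range]
    have : Finite (bitSpan b k) := Nat.finite_of_card_ne_zero (by simp [hcard])
    have := Module.natCard_eq_pow_finrank (K := ZMod 2) (V := bitSpan b k)
    rw [hcard, Nat.card_zmod] at this
    exact (Nat.pow_right_injective le_rfl this).symm
  · rw [hcoe, finsum_mem_coe_finset, Finset.sum_image hinj, ← hsum]
    refine Finset.sum_congr rfl fun m hm ↦ ?_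
    rcases eq_or_ne m 0 with rfl | h
    · simp [hw₀, bitSum_zero_right]
    · exact inv_eq_of_mul_eq_one_right (hw m (Finset.mem_range.mp hm) h)

/-- A certificate for a zero-sum subspace of dimension `k` of `𝔽₂[X] / (p)`: `e 0, …, e (k - 1)`
encode a basis and `t m` encodes the inverse of its `m`-th combination. -/
theorem GaloisField.exists_zero_sum_subspace {n p k : ℕ} (e t : ℕ → ℕ) (hn : 1 < n)
    (hp : p.testBit n) (h : (fun x ↦ mulMod n p x n x)^[n] 2 = 2)
    (ht : ∀ m < 2 ^ k, m ≠ 0 →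
      mulMod n p (xorSum (fun i ↦ if m.testBit i then e i else 0) k) n (t m) = 1)
    (ht₀ : t 0 = 0) (hsum : xorSum t (2 ^ k) = 0) :
    ∃ E : Submodule (ZMod 2) (GaloisField 2 n), Module.finrank (ZMod 2) E = k ∧
      ∑ᶠ u ∈ (E : Set (GaloisField 2 n)), u⁻¹ = 0 := by
  obtain ⟨α, hα⟩ := GaloisField.exists_bitSum_pow_eq_zero hn hp h
  refine ⟨_, finrank_bitSpan_and_finsum_inv_eq_zero
    (b := fun i ↦ bitSum (α ^ ·) n (e i)) (w := fun m ↦ bitSum (α ^ ·) n (t m)) ?_ ?_ ?_⟩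
  · intro m hm hm₀
    rw [← bitSum_bitSum, ← bitSum_mulMod hp hα, ht m hm hm₀, bitSum_one _ (by lia), pow_zero]
  · rw [ht₀, bitSum_zero_right]
  · rw [← bitSum_xorSum, hsum, bitSum_zero_right]

/-- The inverses of the combinations of the basis encoded by `1, 2, 4, 1504, 6576` modulo
`X ^ 17 + X ^ 3 + 1`. -/
def inverses17 : List ℕ :=
  [0, 1, 65540, 131064, 32770, 43688, 65532, 112349, 110068, 107878, 75629, 115813, 103689,
    101162, 78332, 122749, 118928, 108601, 68385, 122342, 120407, 127609, 77983, 128720, 2778,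
    44440, 88721, 26060, 30634, 63266, 89329, 102183]

/-- The inverses of the combinations of the basis encoded by `1, 2, 4, 10064, 17992` modulo
`X ^ 19 + X ^ 5 + X ^ 2 + X + 1`. -/
def inverses19 : List ℕ :=
  [0, 1, 262163, 524258, 393242, 349507, 262129, 224698, 267059, 171225, 465795, 101032, 88018,
    118358, 18041, 374075, 483272, 74822, 121832, 111593, 139308, 471705, 489972, 101542, 10079,
    114300, 337851, 214831, 329629, 412734, 376135, 112606]

theorem GaloisField.exists_zero_sum_subspace_seventeen :
    ∃ E : Submodule (ZMod 2) (GaloisField 2 17), Module.finrank (ZMod 2) E = 5 ∧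
      ∑ᶠ u ∈ (E : Set (GaloisField 2 17)), u⁻¹ = 0 :=
  GaloisField.exists_zero_sum_subspace (p := 131081) ([1, 2, 4, 1504, 6576].getD · 0)
    (inverses17.getD · 0) (by norm_num) (by decide +kernel) (by decide +kernel)
    (by decide +kernel) rfl (by decide +kernel)

theorem GaloisField.exists_zero_sum_subspace_nineteen :
    ∃ E : Submodule (ZMod 2) (GaloisField 2 19), Module.finrank (ZMod 2) E = 5 ∧
      ∑ᶠ u ∈ (E : Set (GaloisField 2 19)), u⁻¹ = 0 :=
  GaloisField.exists_zero_sum_subspace (p := 524327) ([1, 2, 4, 10064, 17992].getD · 0)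
    (inverses19.getD · 0) (by norm_num) (by decide +kernel) (by decide +kernel)
    (by decide +kernel) rfl (by decide +kernel)


/-- For `n ∈ {17, 19}` there exists a `5`-dimensional `F₂`-subspace `E` of `F_{2^n}`
that is a zero-sum subspace, i.e. `∑_{u ∈ E, u ≠ 0} u⁻¹ = 0`.  Consequently the
multiplicative inverse function `f_inv(x) = x⁻¹` (with `f_inv(0) = 0`) is not `5`th
order sum-free on `F_{2^17}` and on `F_{2^19}`. -/
theorem exists_zero_sum_subspace_dim_five_17_19 (n : ℕ) (hn : n = 17 ∨ n = 19) :
    (∃ E : Submodule (ZMod 2) (GaloisField 2 n),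
        Module.finrank (ZMod 2) E = 5 ∧
        ∑ᶠ u ∈ {u : GaloisField 2 n | u ∈ E ∧ u ≠ 0}, u⁻¹ = 0) ∧
    ¬(∀ (E : Submodule (ZMod 2) (GaloisField 2 n)) (v : GaloisField 2 n),
        Module.finrank (ZMod 2) E = 5 →
        ∑ᶠ u : E, (v + (u : GaloisField 2 n))⁻¹ ≠ 0) := by
  obtain ⟨E, hE, hsum⟩ : ∃ E : Submodule (ZMod 2) (GaloisField 2 n),
      Module.finrank (ZMod 2) E = 5 ∧ ∑ᶠ u ∈ (E : Set (GaloisField 2 n)), u⁻¹ = 0 := by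
    rcases hn with rfl | rfl
    · exact GaloisField.exists_zero_sum_subspace_seventeen
    · exact GaloisField.exists_zero_sum_subspace_nineteen
  refine ⟨⟨E, hE, ?_⟩, fun h ↦ h E 0 hE ?_⟩
  · refine (finsum_mem_inter_support_eq' _ _ _ fun u hu ↦ ?_).trans hsum
    have hu₀ : u ≠ 0 := by simpa using hu
    simp [hu₀]
  · simp only [zero_add]
    exact (finsum_set_coe_eq_finsum_mem (E : Set (GaloisField 2 n))).trans hsum
end

section
/- Let 1 ≤ k ≤ n, let E be a k-dimensional F_2-subspace of F_{2^n} with F_2-basis u_1,...,u_k, and let G ∈ F_2[X_1,...,X_k] be a polynomial satisfying Δ(X_1,...,X_k)·G(X_1,...,X_k) = Δ_1(X_1,...,X_k). Then E is a zero-sum subspace, i.e., ∑_{u∈E, u≠0} u^{-1} = 0, if and only if G(u_1,...,u_k) = 0 (evaluation in F_{2^n}). -/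
open MvPolynomial

/-- The Moore determinant `Δ(X_1,…,X_k) = det (X_j^{2^{i-1}})_{1 ≤ i,j ≤ k}` over `F₂`. -/
noncomputable def MooreDet (k : ℕ) : MvPolynomial (Fin k) (ZMod 2) :=
  Matrix.det (Matrix.of fun i j : Fin k =>
    (X j : MvPolynomial (Fin k) (ZMod 2)) ^ 2 ^ (i : ℕ))

/-- `Δ₁(X_1,…,X_k)`: the determinant of the `k×k` matrix whose rows consist of
`X_j^{2^0}, X_j^{2^2}, X_j^{2^3}, …, X_j^{2^k}` (exponents `2^0` and `2^i` for
`2 ≤ i ≤ k`). -/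
noncomputable def MooreDet1 (k : ℕ) : MvPolynomial (Fin k) (ZMod 2) :=
  Matrix.det (Matrix.of fun i j : Fin k =>
    (X j : MvPolynomial (Fin k) (ZMod 2)) ^ 2 ^ (if (i : ℕ) = 0 then 0 else (i : ℕ) + 1))

/-- The `2`-linearized polynomial `∑ i, c i * X ^ 2 ^ i`. -/
noncomputable def linearizedPoly {F : Type*} [Field F] {m : ℕ} (c : Fin m → F) :
    Polynomial F :=
  ∑ i, Polynomial.C (c i) * Polynomial.X ^ 2 ^ (i : ℕ)

section LinearizedPoly

variable {F : Type*} [Field F]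

lemma coeff_linearizedPoly {m : ℕ} (c : Fin m → F) (i : Fin m) :
    (linearizedPoly c).coeff (2 ^ (i : ℕ)) = c i := by
  simp [linearizedPoly, Polynomial.coeff_X_pow, Fin.val_inj]

lemma linearizedPoly_ne_zero {m : ℕ} {c : Fin m → F} (hc : c ≠ 0) :
    linearizedPoly c ≠ 0 := by
  contrapose! hc
  ext i
  rw [← coeff_linearizedPoly c i, hc]
  simp

lemma natDegree_linearizedPoly_le {m : ℕ} (c : Fin (m + 1) → F) :
    (linearizedPoly c).natDegree ≤ 2 ^ m :=
  Polynomial.natDegree_sum_le_of_forall_le _ _ fun i _ =>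
    (Polynomial.natDegree_C_mul_X_pow_le _ _).trans
      (Nat.pow_le_pow_right two_pos (Nat.le_of_lt_succ i.isLt))

lemma eval_linearizedPoly {m : ℕ} (c : Fin m → F) (x : F) :
    (linearizedPoly c).eval x = ∑ i, c i * x ^ 2 ^ (i : ℕ) := by
  simp [linearizedPoly, Polynomial.eval_finsetSum]

lemma eval_linearizedPoly_eq_zero_of_mem_span [Algebra (ZMod 2) F] {m : ℕ} (c : Fin m → F)
    {s : Set F} (hs : ∀ x ∈ s, (linearizedPoly c).eval x = 0) {x : F}
    (hx : x ∈ Submodule.span (ZMod 2) s) : (linearizedPoly c).eval x = 0 := by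
  have : CharP F 2 := charP_of_injective_algebraMap (algebraMap (ZMod 2) F).injective 2
  induction hx using Submodule.span_induction with
  | mem x h => exact hs x h
  | zero => simp [eval_linearizedPoly]
  | add x y _ _ hx hy =>
    rw [eval_linearizedPoly] at hx hy ⊢
    simp [add_pow_char_pow, mul_add, Finset.sum_add_distrib, hx, hy]
  | smul a x _ hx =>
    rw [eval_linearizedPoly] at hx ⊢
    simp [smul_pow, ZMod.pow_card_pow, ← Finset.smul_sum, hx]

lemma exists_linearizedPoly_vanishing {k : ℕ} (u : Fin k → F) :
    ∃ c : Fin (k + 1) → F, c ≠ 0 ∧ ∀ j, ∑ i, c i * u j ^ 2 ^ (i : ℕ) = 0 := by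
  let A : Matrix (Fin (k + 1)) (Fin k) F := Matrix.of fun i j => u j ^ 2 ^ (i : ℕ)
  obtain ⟨c, hc, hc0⟩ := Submodule.exists_mem_ne_zero_of_ne_bot
    (LinearMap.ker_ne_bot_of_finrank_lt (f := A.vecMulLinear) (by simp))
  exact ⟨c, hc0, fun j => congrFun (LinearMap.mem_ker.1 hc) j⟩

end LinearizedPoly

section VanishingPoly

variable {F : Type*} [Field F]

lemma coeff_one_prod_X_sub_C (S : Finset F) (hS : (0 : F) ∉ S) :
    (∏ x ∈ S, (Polynomial.X - Polynomial.C x)).coeff 1 =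
      -(∏ x ∈ S, -x) * ∑ x ∈ S, x⁻¹ := by
  classical
  induction S using Finset.induction_on with
  | empty => simp [Polynomial.coeff_one]
  | insert a S ha ih =>
    simp only [Finset.mem_insert, not_or] at hS
    have ha0 : a ≠ 0 := Ne.symm hS.1
    rw [Finset.prod_insert ha, Finset.prod_insert ha, Finset.sum_insert ha,
      Polynomial.mul_coeff_one, ih hS.2, Polynomial.coeff_zero_prod]
    simp
    field_simp
    ring

lemma prod_X_sub_C_dvd_of_eval_eq_zero {L : Polynomial F} {S : Finset F}
    (hL : ∀ x ∈ S, L.eval x = 0) : ∏ x ∈ S, (Polynomial.X - Polynomial.C x) ∣ L :=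
  Finset.prod_dvd_of_coprime
    (fun _ _ _ _ h => Polynomial.pairwise_coprime_X_sub_C Function.injective_id h)
    fun x hx => Polynomial.dvd_iff_isRoot.2 (hL x hx)

lemma coeff_two_eq_zero_iff_sum_inv_eq_zero [DecidableEq F] {L : Polynomial F} {S : Finset F}
    (h0 : (0 : F) ∈ S) (hL0 : L ≠ 0) (hL : ∀ x ∈ S, L.eval x = 0) (hdeg : L.natDegree ≤ S.card) :
    L.coeff 2 = 0 ↔ ∑ x ∈ S.erase 0, x⁻¹ = 0 := by
  obtain ⟨Q, rfl⟩ := prod_X_sub_C_dvd_of_eval_eq_zero hL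
  have hQ0 : Q ≠ 0 := right_ne_zero_of_mul hL0
  rw [Polynomial.natDegree_mul (left_ne_zero_of_mul hL0) hQ0,
    Polynomial.natDegree_finsetProd_X_sub_C_eq_card] at hdeg
  obtain ⟨q, rfl⟩ := Polynomial.natDegree_eq_zero.1 (show Q.natDegree = 0 by omega)
  have hq : q ≠ 0 := by simpa using hQ0
  have hprod : ∏ x ∈ S.erase 0, -x ≠ 0 :=
    Finset.prod_ne_zero_iff.2 fun x hx => neg_ne_zero.2 (Finset.ne_of_mem_erase hx)
  rw [Polynomial.coeff_mul_C, ← Finset.mul_prod_erase S _ h0, Polynomial.C_0, sub_zero,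
    Polynomial.coeff_X_mul, coeff_one_prod_X_sub_C _ (Finset.notMem_erase 0 S)]
  simp [hq, hprod]

end VanishingPoly

section MooreMatrix

variable {F : Type*} [Field F] [Algebra (ZMod 2) F] {k : ℕ}

lemma aeval_MooreDet (u : Fin k → F) :
    aeval u (MooreDet k) = (Matrix.of fun i j : Fin k => u j ^ 2 ^ (i : ℕ)).det := by
  rw [MooreDet, AlgHom.map_det]
  congr 1
  ext i j
  simp

lemma aeval_MooreDet1 (hk : 1 ≤ k) (u : Fin k → F) :
    aeval u (MooreDet1 k) =
      (Matrix.of fun i j : Fin k => u j ^ 2 ^ ((Fin.succAbove 1 i : Fin (k + 1)) : ℕ)).det := by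
  rw [MooreDet1, AlgHom.map_det]
  congr 1
  ext i j
  have hi : ((Fin.succAbove 1 i : Fin (k + 1)) : ℕ) = if (i : ℕ) = 0 then 0 else (i : ℕ) + 1 := by
    have h1 : ((1 : Fin (k + 1)) : ℕ) = 1 := by
      simp; omega
    simp only [Fin.succAbove, Fin.lt_def, Fin.val_castSucc, h1, Nat.lt_one_iff]
    split_ifs <;> simp [*]
  simp only [AlgHom.mapMatrix_apply, Matrix.map_apply, Matrix.of_apply, map_pow, aeval_X, hi]

lemma aeval_MooreDet_ne_zero {u : Fin k → F} {S : Finset F}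
    (hS : ∀ x ∈ S, x ∈ Submodule.span (ZMod 2) (Set.range u)) (hcard : S.card = 2 ^ k) :
    aeval u (MooreDet k) ≠ 0 := by
  rw [aeval_MooreDet]
  intro hdet
  obtain ⟨c, hc, hcu⟩ := Matrix.exists_vecMul_eq_zero_iff.2 hdet
  obtain _ | k := k
  · exact hc (Subsingleton.elim _ _)
  have hL : ∀ x ∈ S, (linearizedPoly c).eval x = 0 := fun x hx => by
    refine eval_linearizedPoly_eq_zero_of_mem_span c ?_ (hS x hx)
    rintro _ ⟨j, rfl⟩
    rw [eval_linearizedPoly]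
    exact congrFun hcu j
  have hle := Polynomial.natDegree_le_of_dvd (prod_X_sub_C_dvd_of_eval_eq_zero hL)
    (linearizedPoly_ne_zero hc)
  rw [Polynomial.natDegree_finsetProd_X_sub_C_eq_card, hcard] at hle
  have hlt : 2 ^ k < 2 ^ (k + 1) := Nat.pow_lt_pow_right one_lt_two k.lt_succ_self
  exact absurd (hle.trans (natDegree_linearizedPoly_le c)) hlt.not_ge

lemma aeval_MooreDet1_eq_zero_iff (hk : 1 ≤ k) (u : Fin k → F) :
    aeval u (MooreDet1 k) = 0 ↔
      ∃ c : Fin (k + 1) → F, c ≠ 0 ∧ c 1 = 0 ∧ ∀ j, ∑ i, c i * u j ^ 2 ^ (i : ℕ) = 0 := by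
  rw [aeval_MooreDet1 hk, ← Matrix.exists_vecMul_eq_zero_iff]
  constructor
  · rintro ⟨v, hv, hvu⟩
    refine ⟨Fin.insertNth 1 0 v, fun h => hv ?_, by simp, fun j => ?_⟩
    · ext i
      simpa using congrFun h (Fin.succAbove 1 i)
    · rw [Fin.sum_univ_succAbove _ 1]
      simpa [Matrix.vecMul, dotProduct] using congrFun hvu j
  · rintro ⟨c, hc, hc1, hcu⟩
    refine ⟨fun i => c (Fin.succAbove 1 i), fun h => hc ?_, ?_⟩
    · ext i
      obtain rfl | ⟨i, rfl⟩ := Fin.eq_self_or_eq_succAbove 1 i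
      · exact hc1
      · exact congrFun h i
    · ext j
      have := hcu j
      rw [Fin.sum_univ_succAbove _ 1, hc1, zero_mul, zero_add] at this
      simpa [Matrix.vecMul, dotProduct] using this

lemma aeval_MooreDet1_eq_zero_iff_sum_inv_eq_zero [DecidableEq F] (hk : 1 ≤ k) {u : Fin k → F}
    {S : Finset F} (hS : ∀ x ∈ S, x ∈ Submodule.span (ZMod 2) (Set.range u))
    (h0 : (0 : F) ∈ S) (hcard : S.card = 2 ^ k) :
    aeval u (MooreDet1 k) = 0 ↔ ∑ x ∈ S.erase 0, x⁻¹ = 0 := by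
  have key : ∀ c : Fin (k + 1) → F, c ≠ 0 → (∀ j, ∑ i, c i * u j ^ 2 ^ (i : ℕ) = 0) →
      (c 1 = 0 ↔ ∑ x ∈ S.erase 0, x⁻¹ = 0) := fun c hc hcu => by
    have h1 : 2 ^ ((1 : Fin (k + 1)) : ℕ) = 2 := by
      rw [Fin.val_one', Nat.mod_eq_of_lt (by omega), pow_one]
    rw [← coeff_linearizedPoly c 1, h1]
    refine coeff_two_eq_zero_iff_sum_inv_eq_zero h0 (linearizedPoly_ne_zero hc)
      (fun x hx => eval_linearizedPoly_eq_zero_of_mem_span c ?_ (hS x hx))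
      (hcard ▸ natDegree_linearizedPoly_le c)
    rintro _ ⟨j, rfl⟩
    rw [eval_linearizedPoly, hcu]
  rw [aeval_MooreDet1_eq_zero_iff hk]
  constructor
  · rintro ⟨c, hc, hc1, hcu⟩
    exact (key c hc hcu).1 hc1
  · intro hsum
    obtain ⟨c, hc, hcu⟩ := exists_linearizedPoly_vanishing u
    exact ⟨c, hc, (key c hc hcu).2 hsum, hcu⟩

end MooreMatrix

/-- Criterion 1: let `1 ≤ k ≤ n`, let `E` be a `k`-dimensional `F₂`-subspace of
`F_{2^n}` with basis `u_1,…,u_k`, and let `G ∈ F₂[X_1,…,X_k]` satisfy `Δ·G = Δ₁`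
(so `G = F_k`).  Then `E` is a zero-sum subspace, i.e. `∑_{u ∈ E, u ≠ 0} u⁻¹ = 0`,
if and only if `G(u_1,…,u_k) = 0` in `F_{2^n}`. -/
theorem zero_sum_iff_Fk_vanishes (n k : ℕ) (hk : 1 ≤ k) (hkn : k ≤ n)
    (E : Submodule (ZMod 2) (GaloisField 2 n))
    (hE : Module.finrank (ZMod 2) E = k)
    (u : Fin k → GaloisField 2 n)
    (hu_li : LinearIndependent (ZMod 2) u)
    (hu_span : Submodule.span (ZMod 2) (Set.range u) = E)
    (G : MvPolynomial (Fin k) (ZMod 2))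
    (hG : MooreDet k * G = MooreDet1 k) :
    (∑ᶠ x ∈ {x : GaloisField 2 n | x ∈ E ∧ x ≠ 0}, x⁻¹ = 0) ↔
      MvPolynomial.aeval u G = 0 := by
  classical
  have : Finite (GaloisField 2 n) := Module.finite_of_finite (ZMod 2)
  have := Fintype.ofFinite (GaloisField 2 n)
  let S : Finset (GaloisField 2 n) := Finset.univ.filter (· ∈ E)
  have hS : ∀ x ∈ S, x ∈ Submodule.span (ZMod 2) (Set.range u) := fun x hx => by
    rw [hu_span]
    simpa [S] using hx
  have hcard : S.card = 2 ^ k := by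
    have h := Module.card_eq_pow_finrank (K := ZMod 2) (V := E)
    rwa [hE, ZMod.card, Fintype.card_subtype] at h
  have hsum : ∑ᶠ x ∈ {x : GaloisField 2 n | x ∈ E ∧ x ≠ 0}, x⁻¹ = ∑ x ∈ S.erase 0, x⁻¹ := by
    rw [← finsum_mem_coe_finset]
    refine congrArg (fun T : Set (GaloisField 2 n) => ∑ᶠ x ∈ T, x⁻¹) ?_
    ext x
    simp [S]
  rw [hsum, ← aeval_MooreDet1_eq_zero_iff_sum_inv_eq_zero hk hS (by simp [S]) hcard, ← hG,
    map_mul, mul_eq_zero, or_iff_right (aeval_MooreDet_ne_zero hS hcard)]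
end

section
/- Let 1 ≤ k ≤ n and let E be a k-dimensional F_2-subspace of F_{2^n}. Define L_E : F_{2^n} → F_{2^n} by L_E(x) = ∏_{u∈E} (x − u), let E' = {L_E(x) : x ∈ F_{2^n}}, and let W = {y ∈ F_{2^n} : Tr_{F_{2^n}/F_2}(yz) = 0 for all z ∈ E'}. Suppose v_1,...,v_k ∈ W are linearly independent over F_2 and F_2-span W. Then E is a zero-sum subspace, i.e., ∑_{u∈E, u≠0} u^{-1} = 0, if and only if Θ_k(v_1,...,v_k) = 0 (evaluation in F_{2^n}). -/
open MvPolynomial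

open scoped Classical in
/-- `Θ_k = ∑_{λ ∈ Λ_k} m_λ ∈ F₂[X_1,…,X_k]`, where `Λ_k` is the set of partitions of
`2^(k-1)` with at most `k` parts all of which are powers of `2`, and `m_λ` is the
monomial symmetric polynomial associated to `λ` (coefficients reduced mod 2). -/
noncomputable def Theta (k : ℕ) : MvPolynomial (Fin k) (ZMod 2) :=
  ∑ μ ∈ Finset.univ.filter
      (fun μ : Nat.Partition (2 ^ (k - 1)) =>
        μ.parts.card ≤ k ∧ ∀ i ∈ μ.parts, ∃ j, i = 2 ^ j),
    MvPolynomial.msymm (Fin k) (ZMod 2) μ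

namespace TwoPower

theorem sum_digits_two (r a : ℕ) (hr : r < 2) :
    (Nat.digits 2 (r + 2 * a)).sum = r + (Nat.digits 2 a).sum := by
  by_cases h : r ≠ 0 ∨ a ≠ 0
  · rw [Nat.digits_add 2 one_lt_two r a hr h, List.sum_cons]
  · push Not at h
    simp [h.1, h.2]

theorem sum_digits_add_one_le (d : ℕ) :
    (Nat.digits 2 (d + 1)).sum ≤ (Nat.digits 2 d).sum + 1 := by
  induction d using Nat.strong_induction_on with
  | _ d ih =>
    obtain ⟨a, rfl | rfl⟩ := Nat.even_or_odd' d
    · have h1 := sum_digits_two 1 a one_lt_two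
      have h0 := sum_digits_two 0 a two_pos
      rw [zero_add] at h0
      rw [add_comm, h1, h0]
      omega
    · have h1 := sum_digits_two 1 a one_lt_two
      have h0 := sum_digits_two 0 (a + 1) two_pos
      rw [show 2 * a + 1 + 1 = 0 + 2 * (a + 1) by ring, h0, add_comm (2 * a) 1, h1]
      have := ih a (by omega)
      omega

theorem sum_digits_add_two_pow_le (j d : ℕ) :
    (Nat.digits 2 (d + 2 ^ j)).sum ≤ (Nat.digits 2 d).sum + 1 := by
  induction j generalizing d with
  | zero => exact sum_digits_add_one_le d
  | succ j ih =>
    have hd : d = d % 2 + 2 * (d / 2) := by omega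
    have h1 := sum_digits_two (d % 2) (d / 2 + 2 ^ j) (Nat.mod_lt _ two_pos)
    have h2 := sum_digits_two (d % 2) (d / 2) (Nat.mod_lt _ two_pos)
    have h3 := ih (d / 2)
    rw [show d + 2 ^ (j + 1) = d % 2 + 2 * (d / 2 + 2 ^ j) by rw [pow_succ]; omega, h1]
    rw [← hd] at h2
    omega

theorem sum_digits_two_pow_sub_one (k : ℕ) : (Nat.digits 2 (2 ^ k - 1)).sum = k := by
  induction k with
  | zero => simp
  | succ k ih =>
    have h := sum_digits_two 1 (2 ^ k - 1) one_lt_two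
    have : 0 < 2 ^ k := by positivity
    rw [show 2 ^ (k + 1) - 1 = 1 + 2 * (2 ^ k - 1) by rw [pow_succ]; omega, h, ih]
    omega

theorem sum_digits_sum_le_card {ι : Type*} (s : Finset ι) (l : ι → ℕ)
    (hl : ∀ i ∈ s, l i = 0 ∨ ∃ j, l i = 2 ^ j) :
    (Nat.digits 2 (∑ i ∈ s, l i)).sum ≤ s.card := by
  classical
  induction s using Finset.induction_on with
  | empty => simp
  | insert a s ha ih =>
    rw [Finset.sum_insert ha, Finset.card_insert_of_notMem ha]
    have h := ih fun i hi => hl i (Finset.mem_insert_of_mem hi)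
    rcases hl a (Finset.mem_insert_self a s) with h0 | ⟨j, hj⟩
    · rw [h0, zero_add]
      omega
    · rw [hj, add_comm]
      have := sum_digits_add_two_pow_le j (∑ i ∈ s, l i)
      omega

open scoped Classical in
/-- The power series `∑_j (aX)^(2^j)`. -/
noncomputable def series {K : Type*} [Field K] (a : K) : PowerSeries K :=
  PowerSeries.mk fun d => if ∃ j, d = 2 ^ j then a ^ d else 0

section

variable {K : Type*} [Field K]

theorem coeff_series_two_pow (a : K) (j : ℕ) :
    PowerSeries.coeff (2 ^ j) (series a) = a ^ 2 ^ j := by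
  simp [series]

theorem coeff_series_of_not (a : K) {d : ℕ} (h : ¬ ∃ j, d = 2 ^ j) :
    PowerSeries.coeff d (series a) = 0 := by
  simp only [series, PowerSeries.coeff_mk, if_neg h]

theorem coeff_sq_two_mul [CharP K 2] (f : PowerSeries K) (d : ℕ) :
    PowerSeries.coeff (2 * d) (f * f) = PowerSeries.coeff d f ^ 2 := by
  rw [PowerSeries.coeff_mul, ← Finset.sum_erase_add _ _
    (show (d, d) ∈ Finset.HasAntidiagonal.antidiagonal (2 * d) by simp [two_mul]), sq, add_eq_right]
  refine Finset.sum_involution (fun p _ => (p.2, p.1)) ?_ ?_ ?_ ?_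
  · intro p _
    rw [mul_comm, CharTwo.add_self_eq_zero]
  · rintro ⟨p, q⟩ hp _ h
    simp only [Finset.mem_erase, Finset.HasAntidiagonal.mem_antidiagonal, ne_eq, Prod.mk.injEq] at hp h
    omega
  · rintro ⟨p, q⟩ hp
    simp only [Finset.mem_erase, Finset.HasAntidiagonal.mem_antidiagonal, ne_eq, Prod.mk.injEq] at hp ⊢
    omega
  · intro p _
    rfl

theorem coeff_sq_two_mul_add_one [CharP K 2] (f : PowerSeries K) (d : ℕ) :
    PowerSeries.coeff (2 * d + 1) (f * f) = 0 := by
  rw [PowerSeries.coeff_mul]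
  refine Finset.sum_involution (fun p _ => (p.2, p.1)) ?_ ?_ ?_ ?_
  · intro p _
    rw [mul_comm, CharTwo.add_self_eq_zero]
  · rintro ⟨p, q⟩ hp _ h
    simp only [Finset.HasAntidiagonal.mem_antidiagonal, Prod.mk.injEq] at hp h
    omega
  · rintro ⟨p, q⟩ hp
    simp only [Finset.HasAntidiagonal.mem_antidiagonal] at hp ⊢
    omega
  · intro p _
    rfl

theorem series_mul_one_add_series [CharP K 2] (a : K) :
    series a * (1 + series a) = PowerSeries.C a * PowerSeries.X := by
  ext d
  rw [mul_add, mul_one, map_add, PowerSeries.coeff_C_mul, PowerSeries.coeff_X]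
  obtain ⟨m, rfl | rfl⟩ := Nat.even_or_odd' d
  · rw [coeff_sq_two_mul, if_neg (by omega), mul_zero]
    by_cases h : ∃ j, m = 2 ^ j
    · obtain ⟨j, rfl⟩ := h
      rw [← pow_succ', coeff_series_two_pow, coeff_series_two_pow, ← pow_mul, ← pow_succ,
        CharTwo.add_self_eq_zero]
    · rw [coeff_series_of_not a h, coeff_series_of_not a, zero_pow two_ne_zero, add_zero]
      rintro ⟨_ | j, hj⟩
      · simp at hj
      · exact h ⟨j, by rw [pow_succ] at hj; omega⟩
  · rw [coeff_sq_two_mul_add_one, add_zero]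
    rcases Nat.eq_zero_or_pos m with rfl | hm
    · simpa using coeff_series_two_pow a 0
    · rw [coeff_series_of_not, if_neg (by omega), mul_zero]
      rintro ⟨_ | j, hj⟩
      · simp at hj
        omega
      · rw [pow_succ] at hj
        omega

theorem coeff_one_add_series_eq_zero (a : K) {d : ℕ} (h : ¬ (d = 0 ∨ ∃ j, d = 2 ^ j)) :
    PowerSeries.coeff d (1 + series a) = 0 := by
  push Not at h
  rw [map_add, coeff_series_of_not a (by simpa using h.2), PowerSeries.coeff_one, if_neg h.1,
    add_zero]

theorem coeff_one_add_series_eq_pow (a : K) {d : ℕ} (h : d = 0 ∨ ∃ j, d = 2 ^ j) :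
    PowerSeries.coeff d (1 + series a) = a ^ d := by
  rcases h with rfl | ⟨j, rfl⟩
  · rw [map_add, coeff_series_of_not a]
    · simp
    · rintro ⟨j, hj⟩
      exact (pow_ne_zero j two_ne_zero) hj.symm
  · rw [map_add, coeff_series_two_pow, PowerSeries.coeff_one,
      if_neg (pow_ne_zero j two_ne_zero), zero_add]

theorem coeff_prod_eq_zero_of_card_lt {ι : Type*} (s : Finset ι) (v : ι → K) {k : ℕ}
    (hs : s.card < k) :
    PowerSeries.coeff (2 ^ k - 1) (∏ i ∈ s, (1 + series (v i))) = 0 := by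
  classical
  rw [PowerSeries.coeff_prod]
  refine Finset.sum_eq_zero fun l hl => ?_
  rw [Finset.mem_finsuppAntidiag] at hl
  by_contra h
  have hl' : ∀ i ∈ s, l i = 0 ∨ ∃ j, l i = 2 ^ j := by
    intro i hi
    by_contra h'
    exact h (Finset.prod_eq_zero hi (coeff_one_add_series_eq_zero _ h'))
  have := sum_digits_sum_le_card s l hl'
  rw [hl.1, sum_digits_two_pow_sub_one] at this
  omega

/-- The sum of all monomials of degree `d` in the `v i` whose exponents are `0` or
powers of `2`. -/
noncomputable def powSum {k : ℕ} (v : Fin k → K) (d : ℕ) : K :=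
  PowerSeries.coeff d (∏ i, (1 + series (v i)))

theorem powSum_zero {k : ℕ} (v : Fin k → K) : powSum v 0 = 1 := by
  have h : ∀ a : K, PowerSeries.constantCoeff (1 + series a) = 1 := fun a => by
    have := coeff_one_add_series_eq_pow a (d := 0) (Or.inl rfl)
    simpa using this
  rw [powSum, PowerSeries.coeff_zero_eq_constantCoeff_apply, map_prod]
  exact Finset.prod_eq_one fun i _ => h _

theorem sum_powSum_mul_pow_eq_zero [CharP K 2] {k : ℕ} (v : Fin k → K) (i : Fin k) :
    ∑ j ∈ Finset.range (k + 1), powSum v (2 ^ k - 2 ^ j) * v i ^ 2 ^ j = 0 := by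
  have h0 : PowerSeries.coeff (2 ^ k) (series (v i) * ∏ i, (1 + series (v i))) = 0 := by
    rw [← Finset.mul_prod_erase _ _ (Finset.mem_univ i), ← mul_assoc, series_mul_one_add_series,
      mul_assoc, PowerSeries.coeff_C_mul,
      show 2 ^ k = (2 ^ k - 1) + 1 from (Nat.sub_add_cancel Nat.one_le_two_pow).symm,
      PowerSeries.coeff_succ_X_mul, coeff_prod_eq_zero_of_card_lt, mul_zero]
    rw [Finset.card_erase_of_mem (Finset.mem_univ i), Finset.card_univ, Fintype.card_fin]
    have := i.pos
    omega
  rw [← h0, PowerSeries.coeff_mul]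
  refine Finset.sum_of_injOn (fun j => (2 ^ j, 2 ^ k - 2 ^ j)) ?_ ?_ ?_ ?_
  · intro a _ b _ hab
    exact Nat.pow_right_injective le_rfl (congrArg Prod.fst hab)
  · intro j hj
    have hj' : j < k + 1 := by simpa using hj
    have : 2 ^ j ≤ 2 ^ k := Nat.pow_le_pow_right two_pos (by omega)
    simp only [Finset.mem_coe, Finset.HasAntidiagonal.mem_antidiagonal]
    omega
  · rintro ⟨p, q⟩ hpq hn
    rw [Finset.HasAntidiagonal.mem_antidiagonal] at hpq
    simp only at hpq
    refine mul_eq_zero_of_left (coeff_series_of_not _ ?_) _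
    rintro ⟨j, rfl⟩
    refine hn ⟨j, ?_, ?_⟩
    · have : j ≤ k := (Nat.pow_le_pow_iff_right one_lt_two).1 (by omega)
      simpa using by omega
    · simp only [Prod.mk.injEq, true_and]
      omega
  · intro j _
    rw [coeff_series_two_pow, powSum, mul_comm]

theorem aeval_msymm {σ : Type*} [Fintype σ] [DecidableEq σ] [Algebra (ZMod 2) K] (v : σ → K)
    {d : ℕ} (μ : Nat.Partition d) :
    MvPolynomial.aeval v (MvPolynomial.msymm σ (ZMod 2) μ) =
      ∑ s : Sym σ d with Nat.Partition.ofSym s = μ, (s.1.map v).prod := by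
  rw [MvPolynomial.msymm, map_sum, Finset.sum_subtype _ (p := fun s => .ofSym s = μ) (by simp)]
  refine Finset.sum_congr rfl fun s _ => ?_
  rw [map_multiset_prod, Multiset.map_map]
  simp [Function.comp_def]

theorem ofSym_parts_iff {k d : ℕ} (s : Sym (Fin k) d) :
    ((Nat.Partition.ofSym s).parts.card ≤ k ∧
      ∀ i ∈ (Nat.Partition.ofSym s).parts, ∃ j, i = 2 ^ j) ↔
    ∀ i ∈ s.1, ∃ j, s.1.count i = 2 ^ j := by
  have h : s.1.dedup.card ≤ k := by
    simpa using! s.1.toFinset.card_le_univ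
  simp only [Nat.Partition.ofSym, Multiset.card_map, h, true_and]
  simp

open scoped Classical in
theorem aeval_Theta_eq_sum_sym [Algebra (ZMod 2) K] {k : ℕ} (v : Fin k → K) :
    MvPolynomial.aeval v (Theta k) =
      ∑ s : Sym (Fin k) (2 ^ (k - 1)) with ∀ i ∈ s.1, ∃ j, s.1.count i = 2 ^ j,
        (s.1.map v).prod := by
  rw [Theta, map_sum]
  rw [← Finset.sum_fiberwise_of_maps_to (g := fun s => Nat.Partition.ofSym s)
    (t := Finset.univ.filter (fun μ : Nat.Partition (2 ^ (k - 1)) =>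
        μ.parts.card ≤ k ∧ ∀ i ∈ μ.parts, ∃ j, i = 2 ^ j))]
  · refine Finset.sum_congr rfl fun μ hμ => ?_
    have h := aeval_msymm v μ
    convert! h using 1
    refine Finset.sum_congr ?_ fun _ _ => rfl
    ext s
    simp only [Finset.mem_filter, Finset.mem_univ, true_and] at hμ ⊢
    refine ⟨fun hs => hs.2, fun hs => ⟨(ofSym_parts_iff s).1 (hs ▸ hμ), hs⟩⟩
  · intro s hs
    simp only [Finset.mem_filter, Finset.mem_univ, true_and] at hs ⊢
    exact (ofSym_parts_iff s).2 hs

theorem aeval_Theta [Algebra (ZMod 2) K] {k : ℕ} (v : Fin k → K) :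
    MvPolynomial.aeval v (Theta k) = powSum v (2 ^ (k - 1)) := by
  classical
  rw [aeval_Theta_eq_sum_sym, powSum, PowerSeries.coeff_prod]
  refine Finset.sum_of_injOn (fun s => Multiset.toFinsupp s.1) ?_ ?_ ?_ ?_
  · intro s _ t _ hst
    exact Subtype.ext (Multiset.toFinsupp.injective hst)
  · intro s _
    rw [Finset.mem_coe, Finset.mem_finsuppAntidiag]
    refine ⟨?_, Finset.subset_univ _⟩
    exact (Multiset.sum_count_eq_card (s := Finset.univ) (m := s.1) (by simp)).trans s.2
  · intro l hl hn
    rw [Finset.mem_finsuppAntidiag] at hl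
    by_contra h
    have hl' : ∀ i, l i = 0 ∨ ∃ j, l i = 2 ^ j := by
      intro i
      by_contra h'
      exact h (Finset.prod_eq_zero (Finset.mem_univ i) (coeff_one_add_series_eq_zero _ h'))
    refine hn ⟨⟨Finsupp.toMultiset l, ?_⟩, ?_, ?_⟩
    · rw [Finsupp.card_toMultiset, Finsupp.sum_fintype _ _ (by simp)]
      exact hl.1
    · refine Finset.mem_coe.2 (Finset.mem_filter.2 ⟨Finset.mem_univ _, fun i hi => ?_⟩)
      change i ∈ Finsupp.toMultiset l at hi
      change ∃ j, (Finsupp.toMultiset l).count i = 2 ^ j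
      rw [Finsupp.count_toMultiset]
      exact (hl' i).resolve_left (by simpa using hi)
    · exact Finsupp.toMultiset_toFinsupp l
  · intro s hs
    simp only [Finset.mem_filter, Finset.mem_univ, true_and] at hs
    rw [Finset.prod_multiset_map_count, Finset.prod_subset (Finset.subset_univ _)]
    · refine Finset.prod_congr rfl fun i _ => ?_
      rw [Multiset.toFinsupp_apply, coeff_one_add_series_eq_pow]
      by_cases hi : i ∈ s.1
      · exact Or.inr (hs i hi)
      · exact Or.inl (Multiset.count_eq_zero_of_notMem hi)
    · intro i _ hi
      rw [Multiset.count_eq_zero_of_notMem (by simpa using hi), pow_zero]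

end

end TwoPower

namespace Polynomial

open TwoPower

variable {K : Type*} [Field K]

/-- The polynomial `∑_{j ≤ k} c_j X^(2^j)`. -/
noncomputable def linPoly (k : ℕ) (c : ℕ → K) : K[X] :=
  ∑ j ∈ Finset.range (k + 1), C (c j) * X ^ 2 ^ j

theorem eval_linPoly (k : ℕ) (c : ℕ → K) (x : K) :
    (linPoly k c).eval x = ∑ j ∈ Finset.range (k + 1), c j * x ^ 2 ^ j := by
  simp [linPoly, eval_finsetSum]

theorem coeff_linPoly {k j : ℕ} (c : ℕ → K) (hj : j ≤ k) :
    (linPoly k c).coeff (2 ^ j) = c j := by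
  rw [linPoly, finsetSum_coeff, Finset.sum_eq_single j]
  · simp
  · intro i _ hij
    rw [coeff_C_mul_X_pow, if_neg fun h => hij (Nat.pow_right_injective le_rfl h).symm]
  · intro h
    simp at h
    omega

theorem degree_sub_linPoly_lt {k : ℕ} {c d : ℕ → K} (h : c k = d k) :
    (linPoly k c - linPoly k d).degree < (2 ^ k : ℕ) := by
  rw [linPoly, linPoly, ← Finset.sum_sub_distrib, Finset.sum_range_succ, h, sub_self, add_zero,
    ← mem_degreeLT]
  refine Submodule.sum_mem _ fun j hj => ?_
  rw [← sub_mul, ← C_sub, mem_degreeLT]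
  refine (degree_C_mul_X_pow_le _ _).trans_lt ?_
  exact_mod_cast Nat.pow_lt_pow_right one_lt_two (Finset.mem_range.1 hj)

theorem monic_linPoly {k : ℕ} {c : ℕ → K} (h : c k = 1) :
    (linPoly k c).degree = (2 ^ k : ℕ) ∧ (linPoly k c).leadingCoeff = 1 := by
  have hc := coeff_linPoly c (le_refl k)
  have hle : (linPoly k c).natDegree ≤ 2 ^ k := by
    refine natDegree_sum_le_of_forall_le _ _ fun j hj => ?_
    refine (natDegree_C_mul_X_pow_le _ _).trans (Nat.pow_le_pow_right two_pos ?_)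
    have := Finset.mem_range.1 hj
    omega
  have hn : (linPoly k c).natDegree = 2 ^ k :=
    natDegree_eq_of_le_of_coeff_ne_zero hle (by rw [hc, h]; exact one_ne_zero)
  have h0 : linPoly k c ≠ 0 := by
    intro h0
    rw [h0] at hc
    simp [h] at hc
  refine ⟨by rw [degree_eq_natDegree h0, hn], ?_⟩
  rw [leadingCoeff, hn, hc, h]

theorem eval_linPoly_eq_zero_of_mem_span [CharP K 2] [Module (ZMod 2) K] {ι : Type*} (v : ι → K)
    {k : ℕ} {c : ℕ → K} (h : ∀ i, (linPoly k c).eval (v i) = 0) {x : K}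
    (hx : x ∈ Submodule.span (ZMod 2) (Set.range v)) : (linPoly k c).eval x = 0 := by
  induction hx using Submodule.span_induction with
  | mem x hx =>
    obtain ⟨i, rfl⟩ := hx
    exact h i
  | zero =>
    rw [eval_linPoly]
    exact Finset.sum_eq_zero fun j _ => by rw [zero_pow (by positivity), mul_zero]
  | add x y _ _ hx hy =>
    rw [eval_linPoly] at hx hy ⊢
    simp_rw [add_pow_char_pow, mul_add, Finset.sum_add_distrib, hx, hy, add_zero]
  | smul a x _ hx =>
    have ha : a = 0 ∨ a = 1 := by revert a; decide
    rcases ha with rfl | rfl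
    · rw [zero_smul, eval_linPoly]
      exact Finset.sum_eq_zero fun j _ => by rw [zero_pow (by positivity), mul_zero]
    · rwa [one_smul]

theorem eval_powSum_of_mem_span [CharP K 2] [Module (ZMod 2) K] {k : ℕ} (v : Fin k → K) {x : K}
    (hx : x ∈ Submodule.span (ZMod 2) (Set.range v)) :
    (linPoly k fun j => powSum v (2 ^ k - 2 ^ j)).eval x = 0 := by
  refine eval_linPoly_eq_zero_of_mem_span v (fun i => ?_) hx
  rw [eval_linPoly]
  exact sum_powSum_mul_pow_eq_zero v i

theorem card_of_basis_span [Module (ZMod 2) K] {k : ℕ} {v : Fin k → K}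
    (hv : LinearIndependent (ZMod 2) v) {S : Finset K}
    (hS : (S : Set K) = Submodule.span (ZMod 2) (Set.range v)) : S.card = 2 ^ k := by
  have h1 : Module.finrank (ZMod 2) (Submodule.span (ZMod 2) (Set.range v)) = k := by
    simpa using finrank_span_eq_card hv
  have : Module.Finite (ZMod 2) (Submodule.span (ZMod 2) (Set.range v)) :=
    Module.Finite.span_of_finite _ (Set.finite_range v)
  have h2 := Module.natCard_eq_pow_finrank (K := ZMod 2)
    (V := Submodule.span (ZMod 2) (Set.range v))
  rw [h1, Nat.card_zmod] at h2
  rw [← h2, ← Set.ncard_coe_finset, hS]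
  rfl

theorem prod_X_sub_C_eq_linPoly [CharP K 2] [Module (ZMod 2) K] {k : ℕ} {v : Fin k → K}
    (hv : LinearIndependent (ZMod 2) v) {S : Finset K}
    (hS : (S : Set K) = Submodule.span (ZMod 2) (Set.range v)) :
    ∏ u ∈ S, (X - C u) = linPoly k fun j => powSum v (2 ^ k - 2 ^ j) := by
  have hm := monic_linPoly (k := k) (c := fun j => powSum v (2 ^ k - 2 ^ j))
    (by rw [Nat.sub_self, powSum_zero])
  have hdeg : (∏ u ∈ S, (X - C u)).degree = (S.card : WithBot ℕ) := by
    rw [degree_prod]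
    simp
  have hcard := card_of_basis_span hv hS
  refine eq_of_degree_le_of_eval_finset_eq S hdeg.le ?_ ?_ ?_
  · rw [hdeg, hm.1, hcard]
  · rw [hm.2]
    exact monic_prod_of_monic _ _ fun u _ => monic_X_sub_C u
  · intro x hx
    rw [eval_powSum_of_mem_span v (SetLike.mem_coe.1 (hS ▸ Finset.mem_coe.2 hx)), eval_prod]
    exact Finset.prod_eq_zero hx (by simp)

/-- If `∏_{u ∈ S} (X - u) = ∑_j c_j X^(2^j)` with `0 ∈ S`, then `c_0 ≠ 0`, and `c_1 = 0` iff the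
inverses of the nonzero elements of `S` sum to zero. -/
theorem sum_inv_eq_zero_iff [DecidableEq K] {k : ℕ} (hk : 1 ≤ k) {c : ℕ → K} {S : Finset K}
    (h0 : 0 ∈ S) (hS : ∏ u ∈ S, (X - C u) = linPoly k c) :
    c 0 ≠ 0 ∧ (∑ u ∈ S.erase 0, u⁻¹ = 0 ↔ c 1 = 0) := by
  have hX : X * ∏ u ∈ S.erase 0, (X - C u) = linPoly k c := by
    rw [← hS, ← Finset.mul_prod_erase _ _ h0, C_0, sub_zero]
  set Q : K[X] := ∏ u ∈ S.erase 0, (X - C u) with hQ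
  have e0 : Q.eval 0 = c 0 := by
    rw [← coeff_linPoly c (Nat.zero_le k), ← hX, pow_zero, ← zero_add 1, coeff_X_mul,
      coeff_zero_eq_eval_zero]
  have e1 : Q.derivative.eval 0 = c 1 := by
    rw [← coeff_linPoly c hk, ← hX, pow_one, ← one_add_one_eq_two, coeff_X_mul,
      ← coeff_zero_eq_eval_zero, coeff_derivative]
    simp
  have hne : Q.eval 0 ≠ 0 := by
    rw [hQ, eval_prod, Finset.prod_ne_zero_iff]
    intro u hu
    simpa using Finset.ne_of_mem_erase hu
  have key : Q.derivative.eval 0 = -(Q.eval 0 * ∑ u ∈ S.erase 0, u⁻¹) := by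
    rw [hQ, derivative_prod_finset, eval_finsetSum, Finset.mul_sum, ← Finset.sum_neg_distrib]
    refine Finset.sum_congr rfl fun u hu => ?_
    have hu0 := Finset.ne_of_mem_erase hu
    rw [← Finset.mul_prod_erase _ _ hu, eval_mul, eval_mul]
    simp
    field_simp
  rw [← e0, ← e1, key, neg_eq_zero, mul_eq_zero]
  exact ⟨hne, by simp [hne]⟩

end Polynomial

section Trace

open Polynomial

variable {K : Type*} [Field K] [Finite K] [Algebra (ZMod 2) K]

theorem trace_pow_two_pow (x : K) (m : ℕ) :
    Algebra.trace (ZMod 2) K (x ^ 2 ^ m) = Algebra.trace (ZMod 2) K x := by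
  have : Fintype K := Fintype.ofFinite K
  induction m with
  | zero => simp
  | succ m ih =>
    rw [← ih, pow_succ, pow_mul]
    have h := Algebra.trace_eq_of_algEquiv
      (FiniteField.frobeniusAlgEquivOfAlgebraic (ZMod 2) K) (x ^ 2 ^ m)
    rwa [FiniteField.coe_frobeniusAlgEquivOfAlgebraic, ZMod.card] at h

theorem adjoint_eq_zero [CharP K 2] {n k : ℕ} (hK : Nat.card K = 2 ^ n) (hkn : k ≤ n) (c : ℕ → K)
    {y : K} (hy : ∀ x, Algebra.trace (ZMod 2) K (y * (linPoly k c).eval x) = 0) :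
    (linPoly k fun j => c (k - j) ^ 2 ^ j).eval y = 0 := by
  have hfrob : ∀ x : K, x ^ 2 ^ n = x := fun x => by
    have : Fintype K := Fintype.ofFinite K
    rw [← hK, Nat.card_eq_fintype_card, FiniteField.pow_card]
  set t : K := ∑ j ∈ Finset.range (k + 1), (y * c j) ^ 2 ^ (n - j) with ht
  have ht0 : t = 0 := by
    refine (traceForm_nondegenerate (ZMod 2) K).1 t fun x => ?_
    rw [Algebra.traceForm_apply, ← hy x, eval_linPoly, ht, Finset.sum_mul, Finset.mul_sum,
      map_sum, map_sum]
    refine Finset.sum_congr rfl fun j hj => ?_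
    have hjk := Finset.mem_range.1 hj
    rw [← trace_pow_two_pow (y * (c j * x ^ 2 ^ j)) (n - j), ← mul_assoc, mul_pow _ (x ^ _),
      ← pow_mul, ← pow_add, Nat.add_sub_cancel' (by omega), hfrob]
  have h1 : t ^ 2 ^ k = 0 := by rw [ht0, zero_pow (by positivity)]
  rw [ht, sum_pow_char_pow] at h1
  rw [eval_linPoly, ← Finset.sum_range_reflect, ← h1]
  refine Finset.sum_congr rfl fun j hj => ?_
  have hjk := Finset.mem_range.1 hj
  rw [← pow_mul, ← pow_add, show n - j + k = n + (k - j) by omega, pow_add, pow_mul, hfrob,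
    mul_pow, mul_comm, show k + 1 - 1 - j = k - j by omega, show k - (k - j) = j by omega]

end Trace

/-- Criterion 2: let `1 ≤ k ≤ n` and let `E` be a `k`-dimensional `F₂`-subspace of
`F_{2^n}`.  Let `L_E(x) = ∏_{u ∈ E} (x − u)`, `E' = L_E(F_{2^n})`, and
`W = (E')^⊥ = {y : Tr_{F_{2^n}/F₂}(yz) = 0 for all z ∈ E'}`.  If `v_1,…,v_k` is an
`F₂`-basis of `W`, then `E` is a zero-sum subspace, i.e. `∑_{u ∈ E, u ≠ 0} u⁻¹ = 0`,
if and only if `Θ_k(v_1,…,v_k) = 0` in `F_{2^n}`. -/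
theorem zero_sum_iff_theta_vanishes (n k : ℕ) (hk : 1 ≤ k) (hkn : k ≤ n)
    (E : Submodule (ZMod 2) (GaloisField 2 n))
    (hE : Module.finrank (ZMod 2) E = k)
    (L : GaloisField 2 n → GaloisField 2 n)
    (hL : ∀ x, L x = ∏ᶠ u ∈ (E : Set (GaloisField 2 n)), (x - u))
    (W : Set (GaloisField 2 n))
    (hW : W = {y | ∀ z ∈ Set.range L,
      Algebra.trace (ZMod 2) (GaloisField 2 n) (y * z) = 0})
    (v : Fin k → GaloisField 2 n)
    (hv_li : LinearIndependent (ZMod 2) v)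
    (hv_mem : ∀ i, v i ∈ W)
    (hv_span : (Submodule.span (ZMod 2) (Set.range v) : Set (GaloisField 2 n)) = W) :
    (∑ᶠ x ∈ {x : GaloisField 2 n | x ∈ E ∧ x ≠ 0}, x⁻¹ = 0) ↔
      MvPolynomial.aeval v (Theta k) = 0 := by

  classical
  have : Fintype (GaloisField 2 n) := Fintype.ofFinite _
  have hcard : Nat.card (GaloisField 2 n) = 2 ^ n := GaloisField.card 2 n (by omega)
  set S : Finset (GaloisField 2 n) := Finset.univ.filter (· ∈ E) with hSdef
  have hSE : (S : Set (GaloisField 2 n)) = E := by ext; simp [S]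
  let b := Module.finBasisOfFinrankEq (ZMod 2) E hE
  let w : Fin k → GaloisField 2 n := fun i => b i
  have hw : LinearIndependent (ZMod 2) w :=
    b.linearIndependent.map' E.subtype (Submodule.ker_subtype E)
  have hwspan : Submodule.span (ZMod 2) (Set.range w) = E := by
    have : Set.range w = E.subtype '' Set.range b := by
      rw [← Set.range_comp]
      rfl
    rw [this, Submodule.span_image, b.span_eq, Submodule.map_top, Submodule.range_subtype]
  set c : ℕ → GaloisField 2 n := fun j => TwoPower.powSum w (2 ^ k - 2 ^ j) with hc
  have hprod := Polynomial.prod_X_sub_C_eq_linPoly hw (S := S) (by rw [hSE, hwspan])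
  obtain ⟨hc0, hc1⟩ := Polynomial.sum_inv_eq_zero_iff hk (by simp [S]) hprod
  have hLc : ∀ x, L x = (Polynomial.linPoly k c).eval x := fun x => by
    rw [hL, ← hSE, finprod_mem_coe_finset, hc, ← hprod, Polynomial.eval_prod]
    simp
  have hsum : ∑ᶠ x ∈ {x : GaloisField 2 n | x ∈ E ∧ x ≠ 0}, x⁻¹ = ∑ u ∈ S.erase 0, u⁻¹ := by
    rw [← finsum_mem_coe_finset]
    congr! 3 with x
    simp [S]
  set T : Finset (GaloisField 2 n) := Finset.univ.filter (· ∈ W) with hTdef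
  have hTW : (T : Set (GaloisField 2 n)) = Submodule.span (ZMod 2) (Set.range v) := by
    rw [hv_span]
    ext
    simp [T]
  have hTcard := Polynomial.card_of_basis_span hv_li hTW
  have heq : Polynomial.linPoly k (fun j => c (k - j) ^ 2 ^ j) =
      Polynomial.linPoly k (fun j => c 0 ^ 2 ^ k * TwoPower.powSum v (2 ^ k - 2 ^ j)) := by
    refine Polynomial.eq_of_degree_sub_lt_of_eval_finset_eq T ?_ fun y hy => ?_
    · rw [hTcard]
      refine Polynomial.degree_sub_linPoly_lt ?_
      simp [TwoPower.powSum_zero]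
    · have hyW : y ∈ W := by simpa [T] using hy
      have hyspan : y ∈ Submodule.span (ZMod 2) (Set.range v) := by
        rw [← SetLike.mem_coe, hv_span]
        exact hyW
      rw [adjoint_eq_zero hcard hkn c]
      · have h := Polynomial.eval_powSum_of_mem_span v hyspan
        rw [Polynomial.eval_linPoly] at h ⊢
        simp_rw [mul_assoc]
        rw [← Finset.mul_sum, h, mul_zero]
      · intro x
        rw [hW] at hyW
        rw [← hLc]
        exact hyW _ ⟨x, rfl⟩
  have hcoeff := congrArg (fun p => Polynomial.coeff p (2 ^ (k - 1))) heq
  simp only [Polynomial.coeff_linPoly _ (Nat.sub_le k 1)] at hcoeff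
  rw [show k - (k - 1) = 1 by omega,
    show 2 ^ k - 2 ^ (k - 1) = 2 ^ (k - 1) by
      rw [show k = (k - 1) + 1 by omega, pow_succ, Nat.add_sub_cancel]; omega,
    ← TwoPower.aeval_Theta] at hcoeff
  rw [hsum, hc1]
  constructor
  · intro h
    rw [show c 1 = 0 from h, zero_pow (by positivity)] at hcoeff
    exact (mul_eq_zero.1 hcoeff.symm).resolve_left (pow_ne_zero _ hc0)
  · intro h
    rw [h, mul_zero] at hcoeff
    exact eq_zero_of_pow_eq_zero hcoeff
end

section
/- Let q be a prime power, n ≥ 1, and let E be an F_q-subspace of F_{q^n}. Define L_E : F_{q^n} → F_{q^n} by L_E(x) = ∏_{u∈E} (x − u), let E' = {L_E(x) : x ∈ F_{q^n}}, and define L_{E'} : F_{q^n} → F_{q^n} by L_{E'}(x) = ∏_{v∈E'} (x − v). Then {L_{E'}(x) : x ∈ F_{q^n}} = E (equality of subsets of F_{q^n}). -/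
open Polynomial in
theorem prod_add_sub_algebraMap_addSubgroup {K A : Type*} [Field K] [Fintype K] [Field A]
    [Algebra K A] (S : AddSubgroup K) [Fintype S] (a b : A) :
    ∏ u : S, (a + b - algebraMap K A u) =
      ∏ u : S, (a - algebraMap K A u) + ∏ u : S, (b - algebraMap K A u) := by
  classical
  set p : A[X] := ∏ u : S, (X - C (algebraMap K A u)) with hp
  have eval_p (x : A) : p.eval x = ∏ u : S, (x - algebraMap K A u) := by
    simp [hp, eval_prod]
  have hmonic : p.Monic := monic_prod_of_monic _ _ fun u _ => monic_X_sub_C _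
  have hdeg : p.degree = (Fintype.card S : ℕ) := by
    rw [hp, degree_prod]
    simp
  have hcard : (0 : WithBot ℕ) < (Fintype.card S : ℕ) := by
    exact_mod_cast Fintype.card_pos
  have hzero : taylor b p - p - C (p.eval b) = 0 := by
    refine eq_zero_of_degree_lt_of_eval_finset_eq_zero
      (Finset.univ.image fun u : S => algebraMap K A u) ?_ ?_
    · rw [Finset.card_image_of_injective (f := fun u : S => algebraMap K A u) _
        ((algebraMap K A).injective.comp Subtype.val_injective), Finset.card_univ]
      refine (degree_sub_le _ _).trans_lt (max_lt ?_ (degree_C_le.trans_lt hcard))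
      rw [← hdeg]
      have h : (taylor b p).degree = p.degree := degree_taylor p b
      rw [← h]
      refine degree_sub_lt_left h ?_ ?_
      · rw [Ne, ← degree_eq_bot, h, degree_eq_bot]
        exact hmonic.ne_zero
      · exact leadingCoeff_taylor b p
    · intro x hx
      obtain ⟨u, -, rfl⟩ := Finset.mem_image.1 hx
      have h1 : p.eval (algebraMap K A u) = 0 := by
        rw [eval_p]
        exact Finset.prod_eq_zero (Finset.mem_univ u) (sub_self _)
      have h2 : p.eval (algebraMap K A u + b) = p.eval b := by
        rw [eval_p, eval_p]
        refine Fintype.prod_equiv (Equiv.subRight u) _ _ fun v => ?_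
        simp only [Equiv.subRight_apply, AddSubgroup.coe_sub, map_sub]
        ring
      simp [taylor_eval, h1, h2]
  have h := congrArg (eval a) hzero
  simp only [eval_sub, taylor_eval, eval_C, eval_zero, eval_p] at h
  linear_combination h

/-- The additive map `x ↦ ∏ u ∈ S, (x - u)` on a field extension `A` of `K`. -/
def addSubgroupPolyHom {K : Type*} (A : Type*) [Field K] [Fintype K] [Field A] [Algebra K A]
    (S : AddSubgroup K) [Fintype S] : A →+ A :=
  AddMonoidHom.mk' (fun a => ∏ u : S, (a - algebraMap K A u))
    (prod_add_sub_algebraMap_addSubgroup S)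

section

variable {K : Type*} (A : Type*) [Field K] [Fintype K] [Field A] [Algebra K A]
  (S : AddSubgroup K) [Fintype S]

theorem addSubgroupPolyHom_apply (a : A) :
    addSubgroupPolyHom A S a = ∏ u : S, (a - algebraMap K A u) := rfl

theorem addSubgroupPolyHom_algebraMap (x : K) :
    addSubgroupPolyHom A S (algebraMap K A x) = algebraMap K A (addSubgroupPolyHom K S x) := by
  simp [addSubgroupPolyHom_apply, map_prod]

theorem addSubgroupPolyHom_eq_zero_iff (a : A) :
    addSubgroupPolyHom A S a = 0 ↔ ∃ u ∈ S, algebraMap K A u = a := by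
  simp [addSubgroupPolyHom_apply, Finset.prod_eq_zero_iff, sub_eq_zero, eq_comm (a := a)]

theorem ker_addSubgroupPolyHom : (addSubgroupPolyHom K S).ker = S := by
  ext x
  simp [AddMonoidHom.mem_ker, addSubgroupPolyHom_eq_zero_iff]

theorem card_range_addSubgroupPolyHom_mul_card :
    Nat.card (addSubgroupPolyHom K S).range * Nat.card S = Nat.card K := by
  have h := (addSubgroupPolyHom K S).ker.card_mul_index
  rw [AddSubgroup.index_ker, ker_addSubgroupPolyHom] at h
  rw [← h, mul_comm]

theorem addSubgroupPolyHom_pow_card (a : A) :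
    addSubgroupPolyHom A S (a ^ Fintype.card K) = addSubgroupPolyHom A S a ^ Fintype.card K := by
  obtain ⟨p, hp⟩ := CharP.exists K
  have := Fact.mk (CharP.char_is_prime K p)
  obtain ⟨n, -, hn⟩ := FiniteField.card K p
  have : CharP A p := charP_of_injective_algebraMap (algebraMap K A).injective p
  rw [addSubgroupPolyHom_apply, addSubgroupPolyHom_apply, ← Finset.prod_pow]
  refine Finset.prod_congr rfl fun u _ => ?_
  conv_lhs => rw [← FiniteField.pow_card (u : K), map_pow]
  rw [hn, sub_pow_char_pow]

open Polynomial in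
theorem prod_sub_algebraMap_eq_pow_card_sub (a : A) :
    ∏ x : K, (a - algebraMap K A x) = a ^ Fintype.card K - a := by
  have hmonic : (X ^ Fintype.card K - X : K[X]).Monic :=
    monic_X_pow_sub (by simpa using Fintype.one_lt_card (α := K))
  have h := congrArg (aeval a) (prod_multiset_X_sub_C_of_monic_of_roots_card_eq hmonic (by
    rw [FiniteField.roots_X_pow_card_sub_X,
      FiniteField.X_pow_card_sub_X_natDegree_eq K Fintype.one_lt_card]
    rfl))
  rw [FiniteField.roots_X_pow_card_sub_X] at h
  change aeval a (∏ x : K, (X - C x)) = _ at h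
  simpa [map_prod] using h

theorem addSubgroupPolyHom_range_comp [Fintype (addSubgroupPolyHom K S).range] (a : A) :
    addSubgroupPolyHom A (addSubgroupPolyHom K S).range (addSubgroupPolyHom A S a) =
      a ^ Fintype.card K - a := by
  classical
  rw [← prod_sub_algebraMap_eq_pow_card_sub,
    ← Fintype.prod_fiberwise (addSubgroupPolyHom K S).rangeRestrict, addSubgroupPolyHom_apply]
  refine Finset.prod_congr rfl fun v _ => ?_
  obtain ⟨x, rfl⟩ := (addSubgroupPolyHom K S).rangeRestrict_surjective v
  rw [AddMonoidHom.coe_rangeRestrict, ← addSubgroupPolyHom_algebraMap, ← map_sub,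
    addSubgroupPolyHom_apply]
  have hmem (y : K) : (addSubgroupPolyHom K S).rangeRestrict y =
      (addSubgroupPolyHom K S).rangeRestrict x ↔ y - x ∈ S := by
    rw [Subtype.ext_iff, AddMonoidHom.coe_rangeRestrict, AddMonoidHom.coe_rangeRestrict,
      ← sub_eq_zero, ← map_sub, ← AddMonoidHom.mem_ker, ker_addSubgroupPolyHom]
  let e : S ≃ {y // (addSubgroupPolyHom K S).rangeRestrict y =
      (addSubgroupPolyHom K S).rangeRestrict x} :=
    { toFun u := ⟨u + x, (hmem _).2 (by simp)⟩
      invFun y := ⟨y - x, (hmem _).1 y.2⟩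
      left_inv u := by simp
      right_inv y := by simp }
  refine Fintype.prod_equiv e _ _ fun u => ?_
  simp only [e, Equiv.coe_fn_mk, map_add]
  ring

end

open Polynomial in
theorem surjective_addSubgroupPolyHom {K A : Type*} [Field K] [Fintype K] [Field A] [Algebra K A]
    [IsAlgClosed A] (S : AddSubgroup K) [Fintype S] :
    Function.Surjective (addSubgroupPolyHom A S) := by
  intro a
  have hpos : 0 < (∏ u : S, (X - C (algebraMap K A u))).degree := by
    rw [degree_prod]
    simpa using Fintype.card_pos (α := S)
  obtain ⟨b, hb⟩ := IsAlgClosed.exists_root (∏ u : S, (X - C (algebraMap K A u)) - C a)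
    (by rw [degree_sub_C hpos]; exact hpos.ne')
  exact ⟨b, by simpa [eval_prod, addSubgroupPolyHom_apply, sub_eq_zero] using hb⟩

theorem range_addSubgroupPolyHom_range {K : Type*} [Field K] [Fintype K] (S : AddSubgroup K)
    [Fintype S] [Fintype (addSubgroupPolyHom K S).range] :
    (addSubgroupPolyHom K (addSubgroupPolyHom K S).range).range = S := by
  refine AddSubgroup.eq_of_le_of_card_ge ?_ ?_
  · rintro _ ⟨x, rfl⟩
    let A := AlgebraicClosure K
    obtain ⟨b, hb⟩ := surjective_addSubgroupPolyHom (A := A) S (algebraMap K A x)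
    refine (ker_addSubgroupPolyHom S).le (AddMonoidHom.mem_ker.2 ?_)
    apply (algebraMap K A).injective
    rw [← addSubgroupPolyHom_algebraMap, ← addSubgroupPolyHom_algebraMap, ← hb,
      addSubgroupPolyHom_range_comp, map_sub, addSubgroupPolyHom_pow_card, hb, ← map_pow,
      FiniteField.pow_card, sub_self, map_zero]
  · have h1 := card_range_addSubgroupPolyHom_mul_card S
    have h2 := card_range_addSubgroupPolyHom_mul_card (addSubgroupPolyHom K S).range
    rw [← h1, mul_comm] at h2
    exact (Nat.eq_of_mul_eq_mul_left Nat.card_pos h2).ge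

/-- Let `F_q ⊆ F_{q^n}` be finite fields and let `E` be an `F_q`-subspace of
`K = F_{q^n}`.  With `L_E(x) = ∏_{u ∈ E} (x − u)`, `E' = L_E(K)` and
`L_{E'}(x) = ∏_{v ∈ E'} (x − v)`, we have `L_{E'}(K) = E`. -/
theorem image_LE'_eq (F K : Type*) [Field F] [Fintype F] [Field K] [Fintype K]
    [Algebra F K] (E : Submodule F K)
    (LE : K → K) (hLE : ∀ x, LE x = ∏ᶠ u ∈ (E : Set K), (x - u))
    (LE' : K → K) (hLE' : ∀ x, LE' x = ∏ᶠ v ∈ Set.range LE, (x - v)) :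
    Set.range LE' = (E : Set K) := by
  classical
  have key (S : AddSubgroup K) [Fintype S] (x : K) :
      ∏ᶠ u ∈ (S : Set K), (x - u) = addSubgroupPolyHom K S x := by
    rw [← finprod_set_coe_eq_finprod_mem (f := fun u => x - u)]
    exact finprod_eq_prod_of_fintype _
  have := Fintype.ofFinite E.toAddSubgroup
  have := Fintype.ofFinite (addSubgroupPolyHom K E.toAddSubgroup).range
  have h : LE = addSubgroupPolyHom K E.toAddSubgroup :=
    funext fun x => (hLE x).trans (key E.toAddSubgroup x)
  have h' : LE' = addSubgroupPolyHom K (addSubgroupPolyHom K E.toAddSubgroup).range := by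
    funext x
    rw [hLE', h, ← key, AddMonoidHom.coe_range]
  rw [h', ← AddMonoidHom.coe_range, range_addSubgroupPolyHom_range, Submodule.coe_toAddSubgroup]
end

section
/- Let K/F be a finite Galois field extension of degree n whose Galois group is cyclic, generated by σ. Let 0 ≤ k ≤ n and let E be a k-dimensional F-subspace of K. Then there exists a unique tuple (a_0, a_1, ..., a_k) ∈ K^{k+1} with a_k = 1 such that the F-linear map K → K given by x ↦ a_0 σ^0(x) + a_1 σ^1(x) + ... + a_k σ^k(x) has kernel exactly E. -/
section MooreMatrix

variable {F K : Type*} [Field F] [Field K] [Algebra F K]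

/-- If only scalars are fixed by `σ`, the Moore matrix of linearly independent elements
has trivial right kernel. -/
theorem LinearIndependent.eq_zero_of_sum_mul_pow_apply_eq_zero {σ : K ≃ₐ[F] K}
    (hfix : ∀ x, σ x = x → x ∈ Set.range (algebraMap F K)) {m : ℕ} {v : Fin m → K}
    (hv : LinearIndependent F v) {c : Fin m → K}
    (hc : ∀ i : Fin m, ∑ j, c j * (σ ^ (i : ℕ)) (v j) = 0) : c = 0 := by
  induction m with
  | zero => exact Subsingleton.elim _ _
  | succ m ih =>
    have hσv : LinearIndependent F fun j : Fin m => σ (v j.castSucc) :=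
      (hv.comp _ (Fin.castSucc_injective m)).map' σ.toLinearMap
        (LinearMap.ker_eq_bot.2 σ.injective)
    have hlast : c (Fin.last m) = 0 := by
      by_contra hne
      set d : Fin (m + 1) → K := fun j => c j / c (Fin.last m) with hd
      have hdl : d (Fin.last m) = 1 := div_self hne
      have hds (i : Fin (m + 1)) : ∑ j, d j * (σ ^ (i : ℕ)) (v j) = 0 := by
        simp only [hd, div_mul_eq_mul_div, ← Finset.sum_div, hc i, zero_div]
      have hz : (fun j : Fin m => σ (d j.castSucc) - d j.castSucc) = 0 := by
        refine ih hσv fun i => ?_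
        have h₁ := congrArg σ (hds i.castSucc)
        have h₂ := hds i.succ
        simp only [map_sum, map_mul, map_zero, Fin.val_castSucc, Fin.val_succ,
          ← AlgEquiv.mul_apply, ← pow_succ'] at h₁ h₂
        rw [Fin.sum_univ_castSucc, hdl] at h₁ h₂
        simp only [sub_mul, Finset.sum_sub_distrib, ← AlgEquiv.mul_apply, ← pow_succ]
        rw [map_one] at h₁
        linear_combination h₁ - h₂
      have hfd (j : Fin (m + 1)) : ∃ f : F, algebraMap F K f = d j := by
        refine hfix _ ?_
        induction j using Fin.lastCases with
        | last => rw [hdl, map_one]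
        | cast j => exact sub_eq_zero.1 (congrFun hz j)
      choose f hf using hfd
      have h₀ := Fintype.linearIndependent_iff.1 hv f
        (by simpa [Algebra.smul_def, hf] using hds 0) (Fin.last m)
      have := hf (Fin.last m)
      rw [h₀, hdl, map_zero] at this
      exact zero_ne_one this
    have hinit : (fun j : Fin m => c j.castSucc) = 0 := by
      refine ih (hv.comp _ (Fin.castSucc_injective m)) fun i => ?_
      simpa [Fin.sum_univ_castSucc, hlast] using hc i.castSucc
    funext j
    induction j using Fin.lastCases with
    | last => exact hlast
    | cast j => exact congrFun hinit j

/-- If only scalars are fixed by `σ`, the Moore matrix of linearly independent elements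
is invertible. -/
theorem LinearIndependent.isUnit_matrix_pow_apply {σ : K ≃ₐ[F] K}
    (hfix : ∀ x, σ x = x → x ∈ Set.range (algebraMap F K)) {m : ℕ} {v : Fin m → K}
    (hv : LinearIndependent F v) :
    IsUnit (Matrix.of fun i j : Fin m => (σ ^ (i : ℕ)) (v j)) := by
  rw [← Matrix.mulVec_injective_iff_isUnit]
  intro c c' h
  refine sub_eq_zero.1 (hv.eq_zero_of_sum_mul_pow_apply_eq_zero hfix fun i => ?_)
  have := congrFun h i
  simp only [Matrix.mulVec, dotProduct, Matrix.of_apply] at this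
  simp only [Pi.sub_apply, sub_mul, Finset.sum_sub_distrib, sub_eq_zero]
  simpa only [mul_comm] using this

/-- A nonzero polynomial in `σ` with `m` coefficients has kernel of dimension less than `m`. -/
theorem finrank_ker_sum_smul_pow_lt [FiniteDimensional F K] {σ : K ≃ₐ[F] K}
    (hfix : ∀ x, σ x = x → x ∈ Set.range (algebraMap F K)) {m : ℕ} {a : Fin m → K}
    (ha : a ≠ 0) :
    Module.finrank F
      (LinearMap.ker (∑ i : Fin m, a i • ((σ ^ (i : ℕ)).toLinearMap))) < m := by
  by_contra! h
  obtain ⟨w, hw⟩ := exists_linearIndependent_of_le_finrank h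
  have hv := hw.map' (Submodule.subtype _) (Submodule.ker_subtype _)
  refine ha (Matrix.vecMul_injective_iff_isUnit.2 (hv.isUnit_matrix_pow_apply hfix) ?_)
  funext j
  have hj := LinearMap.mem_ker.1 (w j).2
  simpa [-AlgEquiv.coe_pow, -LinearMap.map_coe_ker, Matrix.vecMul, dotProduct] using hj

end MooreMatrix

/-- Let `K/F` be a finite Galois extension of degree `n` with cyclic Galois group
generated by `σ`.  For each `k`-dimensional `F`-subspace `E` of `K` (`0 ≤ k ≤ n`)
there is a unique tuple `(a_0,…,a_k) ∈ K^{k+1}` with `a_k = 1` such that the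
`F`-linear map `x ↦ a_0 σ⁰(x) + a_1 σ¹(x) + ⋯ + a_k σᵏ(x)` has kernel exactly `E`. -/
theorem existsUnique_linearized_with_kernel
    (F K : Type*) [Field F] [Field K] [Algebra F K]
    [FiniteDimensional F K] [IsGalois F K]
    (n : ℕ) (hn : Module.finrank F K = n)
    (σ : K ≃ₐ[F] K) (hσ : ∀ τ : K ≃ₐ[F] K, τ ∈ Subgroup.zpowers σ)
    (k : ℕ) (hk : k ≤ n)
    (E : Submodule F K) (hE : Module.finrank F E = k) :
    ∃! a : Fin (k + 1) → K, a (Fin.last k) = 1 ∧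
      LinearMap.ker (∑ i : Fin (k + 1), a i • ((σ ^ (i : ℕ)).toLinearMap)) = E := by
  have hfix : ∀ x, σ x = x → x ∈ Set.range (algebraMap F K) := fun x hx => by
    refine (IsGalois.mem_range_algebraMap_iff_fixed x).2 fun τ => ?_
    have hle : Subgroup.zpowers σ ≤ MulAction.stabilizer (K ≃ₐ[F] K) x :=
      Subgroup.zpowers_le.2 hx
    exact hle (hσ τ)
  let b := Module.finBasisOfFinrankEq F E hE
  have hv : LinearIndependent F fun j => (b j : K) :=
    b.linearIndependent.map' E.subtype E.ker_subtype
  have hM := hv.isUnit_matrix_pow_apply hfix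
  obtain ⟨a, ha⟩ := Matrix.vecMul_surjective_iff_isUnit.2 hM fun j => -(σ ^ k) (b j : K)
  have hsnoc : (Fin.snoc a 1 : Fin (k + 1) → K) (Fin.last k) = 1 := Fin.snoc_last _ _
  refine ⟨Fin.snoc a 1, ⟨hsnoc, ?_⟩, ?_⟩
  · set L := ∑ i : Fin (k + 1),
      (Fin.snoc a 1 : Fin (k + 1) → K) i • ((σ ^ (i : ℕ)).toLinearMap) with hL
    have hle : E ≤ LinearMap.ker L := by
      have hcomp : L ∘ₗ E.subtype = 0 := b.ext fun j => by
        have := congrFun ha j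
        simp only [Matrix.vecMul, dotProduct, Matrix.of_apply] at this
        simp [-AlgEquiv.coe_pow, hL, Fin.sum_univ_castSucc, this]
      exact fun x hx => LinearMap.congr_fun hcomp ⟨x, hx⟩
    refine (Submodule.eq_of_le_of_finrank_le hle ?_).symm
    rw [hE]
    refine Nat.lt_succ_iff.1 (finrank_ker_sum_smul_pow_lt hfix fun h => ?_)
    rw [h] at hsnoc
    exact zero_ne_one hsnoc
  · rintro a' ⟨hlast, hker⟩
    have hinit : (fun i : Fin k => a' i.castSucc) = a := by
      refine Matrix.vecMul_injective_iff_isUnit.2 hM ?_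
      change Matrix.vecMul _ _ = Matrix.vecMul _ _
      refine Eq.trans ?_ ha.symm
      funext j
      have hj : (b j : K) ∈ LinearMap.ker
          (∑ i : Fin (k + 1), a' i • ((σ ^ (i : ℕ)).toLinearMap)) := hker ▸ (b j).2
      simp only [LinearMap.mem_ker, Fin.sum_univ_castSucc, hlast] at hj
      simpa [-AlgEquiv.coe_pow, Matrix.vecMul, dotProduct] using eq_neg_of_add_eq_zero_left hj
    funext i
    induction i using Fin.lastCases with
    | last => rw [hlast, hsnoc]
    | cast i => rw [Fin.snoc_castSucc, ← hinit]
end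

section
/- Let K/F be a finite-dimensional Galois field extension with n = [K:F], and let σ_1, ..., σ_n be an enumeration of the n elements of Aut(K/F). Then elements b_1, ..., b_k ∈ K are linearly independent over F if and only if the n×k matrix B with (i,j) entry σ_i(b_j) has rank k (rank over the field K). -/
/-- In a finite separable extension, the members of a linearly independent family are separated by
trace pairings. -/
theorem LinearIndependent.exists_trace_mul_eq_pi_single {F K ι : Type*} [Field F] [Field K]
    [Algebra F K] [FiniteDimensional F K] [Algebra.IsSeparable F K] [DecidableEq ι] {b : ι → K}
    (hb : LinearIndependent F b) :
    ∃ a : ι → K, ∀ i j, Algebra.trace F K (a i * b j) = (Pi.single i 1 : ι → F) j := by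
  obtain ⟨g, hg⟩ := (Finsupp.linearCombination F b).exists_leftInverse_of_injective
    (LinearMap.ker_eq_bot.mpr hb)
  have hgb (j : ι) : g (b j) = Finsupp.single j 1 := by
    simpa using LinearMap.congr_fun hg (Finsupp.single j 1)
  let e := (Algebra.traceForm F K).toDual (traceForm_nondegenerate F K)
  refine ⟨fun i ↦ e.symm (Finsupp.lapply i ∘ₗ g), fun i j ↦ ?_⟩
  rw [← Algebra.traceForm_apply, LinearMap.BilinForm.apply_toDual_symm_apply]
  simp [hgb, Finsupp.single_apply, Pi.single_apply, eq_comm]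

/-- A family of columns is linearly independent if and only if the matrix has full column rank. -/
theorem Matrix.linearIndependent_col_iff_rank_eq_card {K m ι : Type*} [Field K]
    [Fintype m] [Fintype ι] (A : Matrix m ι K) :
    LinearIndependent K A.col ↔ A.rank = Fintype.card ι := by
  rw [A.rank_eq_finrank_span_cols, linearIndependent_iff_card_eq_finrank_span, eq_comm,
    Set.finrank]

/-- Let `K/F` be a finite Galois extension with `n = [K:F]` and let `σ_1,…,σ_n` be an
enumeration of the `n` elements of `Aut(K/F)`.  Then `b_1,…,b_k ∈ K` are linearly
independent over `F` if and only if the `n×k` matrix `B = (σ_i(b_j))` has rank `k`. -/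
theorem linearIndependent_iff_rank_eq
    (F K : Type*) [Field F] [Field K] [Algebra F K]
    [FiniteDimensional F K] [IsGalois F K]
    (n : ℕ) (hn : Module.finrank F K = n)
    (σ : Fin n → (K ≃ₐ[F] K)) (hσ : Function.Bijective σ)
    (k : ℕ) (b : Fin k → K) :
    LinearIndependent F b ↔
      (Matrix.of fun (i : Fin n) (j : Fin k) => σ i (b j)).rank = k := by
  refine ⟨fun hb ↦ ?_, fun h ↦ ?_⟩
  · obtain ⟨a, ha⟩ := hb.exists_trace_mul_eq_pi_single
    set B : Matrix (Fin n) (Fin k) K := Matrix.of fun i j ↦ σ i (b j)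
    have hB : (Matrix.of fun (j : Fin k) (i : Fin n) ↦ σ i (a j)) * B = 1 := by
      ext i j
      have h := congrArg (algebraMap F K) (ha i j)
      rw [trace_eq_sum_automorphisms, ← (Equiv.ofBijective σ hσ).sum_comp] at h
      simpa [B, Matrix.mul_apply, Matrix.one_apply, Pi.single_apply, eq_comm, apply_ite] using h
    refine le_antisymm B.rank_le_width ?_
    simpa [hB] using Matrix.rank_mul_le_right (Matrix.of fun j i ↦ σ i (a j)) B
  · have hcol := (Matrix.linearIndependent_col_iff_rank_eq_card _).mpr
      (h.trans (Fintype.card_fin k).symm)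
    exact LinearIndependent.of_comp (LinearMap.pi fun i ↦ (σ i).toLinearMap)
      (hcol.restrict_scalars' F)
end

section
/- Let q be a prime power and n ≥ 2. For every F_q-affine subspace A of F_{q^n}... [restricted to q = 2 as used in the paper]: for every F_2-affine subspace A of F_{2^n} that does not contain 0, ∑_{x∈A} x^{-1} ≠ 0. Consequently, for 1 ≤ k ≤ n−1, the multiplicative inverse function f_inv on F_{2^n} is not kth order sum-free if and only if there exists a k-dimensional F_2-linear subspace E of F_{2^n} with ∑_{u∈E, u≠0} u^{-1} = 0. -/
section InverseSums

variable {K : Type*} [Field K] [Module (ZMod 2) K]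

lemma coe_span_insert_eq_union (w : K) (s : Set K) :
    (Submodule.span (ZMod 2) (insert w s) : Set K) =
      (Submodule.span (ZMod 2) s : Set K) ∪
        (fun x => w + x) '' (Submodule.span (ZMod 2) s : Set K) := by
  ext x
  simp only [SetLike.mem_coe, Submodule.mem_span_insert, Set.mem_union, Set.mem_image]
  constructor
  · rintro ⟨a, z, hz, rfl⟩
    obtain rfl | rfl : a = 0 ∨ a = 1 := by
      clear hz
      revert a
      decide
    · left
      simpa using hz
    · right
      exact ⟨z, hz, by simp⟩
  · rintro (hx | ⟨z, hz, rfl⟩)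
    · exact ⟨0, x, hx, by simp⟩
    · exact ⟨1, z, hz, by simp⟩

lemma finsum_inv_add_of_mem {E : Submodule (ZMod 2) K} {v : K} (hv : v ∈ E) :
    ∑ᶠ u : E, (v + (u : K))⁻¹ = ∑ᶠ x ∈ {x : K | x ∈ E ∧ x ≠ 0}, x⁻¹ := by
  have htranslate : ∑ᶠ u : E, (v + (u : K))⁻¹ = ∑ᶠ u : E, (u : K)⁻¹ :=
    finsum_comp_equiv (Equiv.addLeft (⟨v, hv⟩ : E)) (f := fun u : E => (u : K)⁻¹)
  rw [htranslate]
  refine (finsum_set_coe_eq_finsum_mem (f := fun u : K => u⁻¹) (E : Set K)).trans ?_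
  refine finsum_mem_inter_support_eq' _ _ _ fun x hx => ?_
  have hx₀ : x ≠ 0 := by simpa using hx
  simp [hx₀]

variable [CharP K 2]

/-- The additive map `x ↦ L x * L (x + w)` in characteristic two. -/
def AddMonoidHom.mulTranslate (L : K →+ K) (w : K) : K →+ K where
  toFun x := L x * (L x + L w)
  map_zero' := by simp
  map_add' x y := by
    rw [map_add]
    linear_combination (L x * L y) * (CharTwo.two_eq_zero : (2 : K) = 0)

/-- The inverses of the elements of a coset `v + E` with `v ∉ E` sum to `c / L v`, where `L` is
additive with kernel `E` and `c ≠ 0`. -/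
lemma exists_addMonoidHom_sum_inv_eq_div [Finite K] (E : Submodule (ZMod 2) K) :
    ∃ (c : K) (L : K →+ K), c ≠ 0 ∧ (∀ x, L x = 0 ↔ x ∈ E) ∧
      ∀ v, v ∉ E → ∑ᶠ u ∈ (E : Set K), (v + u)⁻¹ = c / L v := by
  suffices h : ∀ s : Set K, s.Finite → ∃ (c : K) (L : K →+ K), c ≠ 0 ∧
      (∀ x, L x = 0 ↔ x ∈ Submodule.span (ZMod 2) s) ∧
      ∀ v, v ∉ Submodule.span (ZMod 2) s →
        ∑ᶠ u ∈ (Submodule.span (ZMod 2) s : Set K), (v + u)⁻¹ = c / L v by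
    simpa using h E (Set.toFinite _)
  intro s hs
  induction s, hs using Set.Finite.induction_on with
  | empty => exact ⟨1, AddMonoidHom.id K, one_ne_zero, by simp, by simp⟩
  | @insert w s _ _ ih =>
    obtain ⟨c, L, hc, hker, hsum⟩ := ih
    by_cases hw : w ∈ Submodule.span (ZMod 2) s
    · rw [Submodule.span_insert_eq_span hw]
      exact ⟨c, L, hc, hker, hsum⟩
    have hmem : ∀ x, x ∈ Submodule.span (ZMod 2) (insert w s) ↔
        x ∈ Submodule.span (ZMod 2) s ∨ x + w ∈ Submodule.span (ZMod 2) s := by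
      intro x
      rw [← SetLike.mem_coe, coe_span_insert_eq_union, Set.mem_union, SetLike.mem_coe]
      refine or_congr_right ⟨?_, fun h => ⟨x + w, h, ?_⟩⟩
      · rintro ⟨z, hz, rfl⟩
        rwa [add_right_comm, CharTwo.add_self_eq_zero, zero_add]
      · change w + (x + w) = x
        rw [add_left_comm, CharTwo.add_self_eq_zero, add_zero]
    refine ⟨c * L w, L.mulTranslate w, mul_ne_zero hc (mt (hker w).1 hw), fun x => ?_,
      fun v hv => ?_⟩
    · change L x * (L x + L w) = 0 ↔ _
      rw [mul_eq_zero, ← map_add, hker, hker, hmem]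
    · obtain ⟨hv₁, hv₂⟩ := not_or.1 (mt (hmem v).2 hv)
      have hdisj : Disjoint (Submodule.span (ZMod 2) s : Set K)
          ((fun x => w + x) '' (Submodule.span (ZMod 2) s : Set K)) := by
        rw [Set.disjoint_left]
        rintro _ hx ⟨z, hz, rfl⟩
        exact hw ((Submodule.add_mem_iff_left _ hz).1 hx)
      rw [coe_span_insert_eq_union, finsum_mem_union hdisj (Set.toFinite _) (Set.toFinite _),
        finsum_mem_image (add_right_injective w).injOn]
      simp only [← add_assoc]
      rw [hsum v hv₁, hsum (v + w) hv₂]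
      have h₁ : L v ≠ 0 := mt (hker v).1 hv₁
      have h₂ : L v + L w ≠ 0 := by
        rw [← map_add]
        exact mt (hker _).1 hv₂
      change _ = c * L w / (L v * (L v + L w))
      rw [map_add]
      field_simp
      linear_combination L v * (CharTwo.two_eq_zero : (2 : K) = 0)

lemma finsum_inv_add_ne_zero [Finite K] {E : Submodule (ZMod 2) K} {v : K} (hv : v ∉ E) :
    ∑ᶠ u : E, (v + (u : K))⁻¹ ≠ 0 := by
  obtain ⟨c, L, hc, hker, hsum⟩ := exists_addMonoidHom_sum_inv_eq_div E
  have h := finsum_set_coe_eq_finsum_mem (f := fun u => (v + u)⁻¹) (E : Set K)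
  refine ne_of_eq_of_ne (h.trans (hsum v hv)) (div_ne_zero hc (mt (hker v).1 hv))

end InverseSums


/-- For every `F₂`-affine subspace `A = v + E` of `F_{2^n}` (`n ≥ 2`) not containing
`0`, `∑_{x ∈ A} x⁻¹ ≠ 0`.  Consequently, for `1 ≤ k ≤ n − 1`, the multiplicative
inverse function `f_inv(x) = x⁻¹` (with `f_inv(0) = 0`) on `F_{2^n}` is not `k`th order
sum-free if and only if there exists a `k`-dimensional `F₂`-linear subspace `E` of
`F_{2^n}` with `∑_{u ∈ E, u ≠ 0} u⁻¹ = 0`. -/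
theorem affine_sum_ne_zero_and_not_sum_free_iff (n : ℕ) (hn : 2 ≤ n) :
    (∀ (E : Submodule (ZMod 2) (GaloisField 2 n)) (v : GaloisField 2 n),
        (0 : GaloisField 2 n) ∉ {x : GaloisField 2 n | ∃ u ∈ E, x = v + u} →
        ∑ᶠ u : E, (v + (u : GaloisField 2 n))⁻¹ ≠ 0) ∧
    (∀ k : ℕ, 1 ≤ k → k ≤ n - 1 →
      (¬(∀ (E : Submodule (ZMod 2) (GaloisField 2 n)) (v : GaloisField 2 n),
            Module.finrank (ZMod 2) E = k →
            ∑ᶠ u : E, (v + (u : GaloisField 2 n))⁻¹ ≠ 0) ↔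
        ∃ E : Submodule (ZMod 2) (GaloisField 2 n),
          Module.finrank (ZMod 2) E = k ∧
          ∑ᶠ x ∈ {x : GaloisField 2 n | x ∈ E ∧ x ≠ 0}, x⁻¹ = 0)) := by
  have hmem : ∀ (E : Submodule (ZMod 2) (GaloisField 2 n)) (v : GaloisField 2 n), v ∈ E →
      (0 : GaloisField 2 n) ∈ {x : GaloisField 2 n | ∃ u ∈ E, x = v + u} :=
    fun E v hv => ⟨-v, E.neg_mem hv, (add_neg_cancel v).symm⟩
  refine ⟨fun E v h => finsum_inv_add_ne_zero (mt (hmem E v) h), fun k _ _ => ?_⟩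
  push Not
  constructor
  · rintro ⟨E, v, hE, h⟩
    have hv : v ∈ E := by
      by_contra hv
      exact finsum_inv_add_ne_zero hv h
    exact ⟨E, hE, (finsum_inv_add_of_mem hv).symm.trans h⟩
  · rintro ⟨E, hE, h⟩
    exact ⟨E, 0, hE, (finsum_inv_add_of_mem E.zero_mem).trans h⟩
end
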